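/- arXiv:1710.11110 — 6 statements merged into one kernel-verified Lean document; each statement's English description precedes it below -/
import Mathlib

section
/- Let 0 → h → e → g → 0 be a short exact sequence of finite-dimensional real Lie algebras, i.e., there is a surjective Lie algebra homomorphism π : e → g whose kernel is h. If g is either a simple Lie algebra or one-dimensional, then the extension splits: there exists a Lie algebra homomorphism τ : g → e with π ∘ τ = id_g. -/
namespace LieModule

open Module

variable {K L M W ι : Type*} [Field K] [LieRing L] [LieAlgebra K L]
  [AddCommGroup M] [Module K M] [LieRingModule L M] [LieModule K L M]
  [AddCommGroup W] [Module K W]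

section DualBasis

variable [Fintype ι]

variable (M) in
/-- The Casimir operator on `M` attached to a pair of bases. -/
noncomputable def casimir (b b' : Basis ι K L) : End K M :=
  ∑ i, toEnd K L M (b i) ∘ₗ toEnd K L M (b' i)

variable {B : LinearMap.BilinForm K L} {b b' : Basis ι K L}

lemma casimir_apply (m : M) : casimir M b b' m = ∑ i, ⁅b i, ⁅b' i, m⁆⁆ := by
  simp [casimir]

lemma trace_casimir (hbb' : ∀ i, traceForm K L M (b' i) (b i) = 1) :
    LinearMap.trace K M (casimir M b b') = Fintype.card ι := by
  simp [casimir, ← traceForm_apply_apply, traceForm_comm K L M (b _), hbb']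

variable [DecidableEq ι]

lemma _root_.Module.Basis.repr_eq_of_dual (hbb' : ∀ i j, B (b' i) (b j) = if i = j then 1 else 0)
    (v : L) (j : ι) : b.repr v j = B (b' j) v := by
  conv_rhs => rw [← b.sum_repr v]
  simp [hbb', -Basis.sum_repr]

lemma _root_.Module.Basis.repr_eq_of_dual' (hbb' : ∀ i j, B (b' i) (b j) = if i = j then 1 else 0)
    (v : L) (j : ι) : b'.repr v j = B v (b j) := by
  conv_rhs => rw [← b'.sum_repr v]
  simp [hbb', -Basis.sum_repr]

/-- The canonical tensor attached to dual bases for an invariant form is invariant, which is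
expressed here through its image under a bilinear map `T`. -/
lemma sum_lie_add_lie_of_dual (hB : B.lieInvariant L)
    (hbb' : ∀ i j, B (b' i) (b j) = if i = j then 1 else 0) (T : L →ₗ[K] L →ₗ[K] W) (x : L) :
    ∑ i, T ⁅x, b i⁆ (b' i) = - ∑ i, T (b i) ⁅x, b' i⁆ := by
  have h₁ (v : L) : v = ∑ j, B (b' j) v • b j := by
    simp_rw [← Basis.repr_eq_of_dual hbb', b.sum_repr]
  have h₂ (v : L) : v = ∑ j, B v (b j) • b' j := by
    simp_rw [← Basis.repr_eq_of_dual' hbb', b'.sum_repr]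
  calc ∑ i, T ⁅x, b i⁆ (b' i)
      = ∑ i, ∑ j, B (b' j) ⁅x, b i⁆ • T (b j) (b' i) := by
        refine Finset.sum_congr rfl fun i _ ↦ ?_
        conv_lhs => rw [h₁ ⁅x, b i⁆]
        simp
    _ = ∑ j, ∑ i, B (b' j) ⁅x, b i⁆ • T (b j) (b' i) := Finset.sum_comm
    _ = - ∑ j, T (b j) ⁅x, b' j⁆ := by
        rw [← Finset.sum_neg_distrib]
        refine Finset.sum_congr rfl fun j _ ↦ ?_
        conv_rhs => rw [h₂ ⁅x, b' j⁆]
        simp [hB x (b' j)]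

lemma casimir_lie (hB : B.lieInvariant L)
    (hbb' : ∀ i j, B (b' i) (b j) = if i = j then 1 else 0) (x : L) (m : M) :
    casimir M b b' ⁅x, m⁆ = ⁅x, casimir M b b' m⁆ := by
  let T : L →ₗ[K] L →ₗ[K] M :=
    LinearMap.mk₂ K (fun a a' ↦ ⁅a, ⁅a', m⁆⁆) (by simp) (by simp) (by simp) (by simp)
  have key : ∑ i, ⁅⁅x, b i⁆, ⁅b' i, m⁆⁆ = - ∑ i, ⁅b i, ⁅⁅x, b' i⁆, m⁆⁆ :=
    sum_lie_add_lie_of_dual hB hbb' T x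
  have hx (i : ι) : ⁅x, ⁅b i, ⁅b' i, m⁆⁆⁆ =
      ⁅⁅x, b i⁆, ⁅b' i, m⁆⁆ + ⁅b i, ⁅⁅x, b' i⁆, m⁆⁆ + ⁅b i, ⁅b' i, ⁅x, m⁆⁆⁆ := by
    rw [leibniz_lie x (b i), leibniz_lie x (b' i), lie_add, add_assoc]
  simp_rw [casimir_apply, lie_sum, hx, Finset.sum_add_distrib, key]
  abel

/-- The Casimir operator of the Killing form is the identity on the adjoint representation. -/
lemma casimir_killingForm [FiniteDimensional K L] [LieAlgebra.IsKilling K L]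
    (hbb' : ∀ i j, killingForm K L (b' i) (b j) = if i = j then 1 else 0) (y : L) :
    casimir L b b' y = y := by
  have hr (A : End K L) : LinearMap.trace K L A = ∑ i, killingForm K L (b' i) (A (b i)) := by
    rw [LinearMap.trace_eq_matrix_trace K b, Matrix.trace]
    refine Finset.sum_congr rfl fun j _ ↦ ?_
    simp [← Basis.repr_eq_of_dual hbb', LinearMap.toMatrix_apply]
  have hnd := (LieAlgebra.IsKilling.killingForm_nondegenerate K L).1
  rw [← sub_eq_zero]
  refine hnd _ fun z ↦ ?_
  rw [map_sub, LinearMap.sub_apply, sub_eq_zero, casimir_apply,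
    traceForm_apply_apply K L L y z, hr, map_sum, LinearMap.sum_apply]
  refine Finset.sum_congr rfl fun i _ ↦ ?_
  rw [← lie_skew (b i), map_neg, LinearMap.neg_apply, traceForm_apply_lie_apply,
    traceForm_apply_lie_apply, LinearMap.comp_apply, toEnd_apply_apply, toEnd_apply_apply,
    ← lie_skew z (b i), lie_neg, map_neg]

/-- **Whitehead's second lemma**, for modules on which a Casimir operator is bijective: every
2-cocycle `f` is a coboundary. -/
lemma exists_coboundary_of_bijective_casimir (hB : B.lieInvariant L)
    (hbb' : ∀ i j, B (b' i) (b j) = if i = j then 1 else 0)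
    (hbij : Function.Bijective (casimir M b b')) (f : L →ₗ[K] L →ₗ[K] M)
    (hf : ∀ u x y, ⁅u, f x y⁆ =
      ⁅x, f u y⁆ - ⁅y, f u x⁆ + f ⁅u, x⁆ y - f ⁅u, y⁆ x - f u ⁅x, y⁆) :
    ∃ q : L →ₗ[K] M, ∀ x y, f x y = ⁅x, q y⁆ - ⁅y, q x⁆ - q ⁅x, y⁆ := by
  let h : L →ₗ[K] M := ∑ i, toEnd K L M (b i) ∘ₗ f (b' i)
  have h_apply (x : L) : h x = ∑ i, ⁅b i, f (b' i) x⁆ := by simp [h]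
  let T (y : L) : L →ₗ[K] L →ₗ[K] M :=
    LinearMap.mk₂ K (fun a a' ↦ ⁅a, f a' y⁆) (by simp) (by simp) (by simp) (by simp)
  have key (x y : L) : ∑ i, ⁅⁅x, b i⁆, f (b' i) y⁆ = - ∑ i, ⁅b i, f ⁅x, b' i⁆ y⁆ :=
    sum_lie_add_lie_of_dual hB hbb' (T y) x
  have hdh (x y : L) : casimir M b b' (f x y) = ⁅x, h y⁆ - ⁅y, h x⁆ - h ⁅x, y⁆ := by
    have hi (i : ι) : ⁅b i, ⁅b' i, f x y⁆⁆ =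
        ⁅x, ⁅b i, f (b' i) y⁆⁆ - ⁅⁅x, b i⁆, f (b' i) y⁆
        - (⁅y, ⁅b i, f (b' i) x⁆⁆ - ⁅⁅y, b i⁆, f (b' i) x⁆)
        - ⁅b i, f ⁅x, b' i⁆ y⁆ + ⁅b i, f ⁅y, b' i⁆ x⁆ - ⁅b i, f (b' i) ⁅x, y⁆⁆ := by
      rw [hf, leibniz_lie x (b i), leibniz_lie y (b i), ← lie_skew (b' i) x, ← lie_skew (b' i) y]
      simp only [lie_add, lie_sub, lie_neg, map_neg, LinearMap.neg_apply]
      abel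
    simp only [casimir_apply, h_apply, lie_sum, hi, Finset.sum_add_distrib, Finset.sum_sub_distrib,
      key]
    abel
  let Ω := LinearEquiv.ofBijective (casimir M b b') hbij
  have hΩ (x : L) (m : M) : Ω.symm ⁅x, m⁆ = ⁅x, Ω.symm m⁆ := by
    rw [LinearEquiv.symm_apply_eq]
    have h₁ : Ω ⁅x, Ω.symm m⁆ = ⁅x, Ω (Ω.symm m)⁆ := casimir_lie hB hbb' x _
    rw [h₁, Ω.apply_symm_apply]
  refine ⟨Ω.symm.toLinearMap ∘ₗ h, fun x y ↦ ?_⟩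
  have h₂ : f x y = Ω.symm (casimir M b b' (f x y)) := (Ω.symm_apply_apply _).symm
  rw [h₂, hdh]
  simp [hΩ]

end DualBasis

variable [CharZero K] [FiniteDimensional K M]

lemma isTrivial_of_traceForm_eq_zero [LieAlgebra.IsSimple K L] [IsIrreducible K L M]
    (h : traceForm K L M = 0) : IsTrivial L M := by
  have hnil := isNilpotent_derivedSeries_of_traceForm_eq_zero h
  have htop : LieAlgebra.derivedSeries K L 1 = ⊤ := by
    refine (LieAlgebra.IsSimple.eq_bot_or_eq_top (R := K) _).resolve_left fun hbot ↦ ?_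
    refine LieAlgebra.IsSimple.non_abelian K (L := L) ?_
    rw [LieAlgebra.derivedSeries_def, ← LieAlgebra.abelian_iff_derived_one_eq_bot] at hbot
    exact (lie_abelian_iff_equiv_lie_abelian LieSubalgebra.topEquiv).mp hbot
  have := LieModule.nontrivial_of_isIrreducible K L M
  have hne := nontrivial_max_triv_of_isNilpotent K (LieAlgebra.derivedSeries K L 1) M
  obtain ⟨⟨m, hm⟩, hm0⟩ := exists_ne (0 : maxTrivSubmodule K (LieAlgebra.derivedSeries K L 1) M)
  have hmem : m ∈ maxTrivSubmodule K L M := fun x ↦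
    hm ⟨x, htop ▸ LieSubmodule.mem_top x⟩
  have hmax : maxTrivSubmodule K L M = ⊤ := by
    refine (eq_bot_or_eq_top _).resolve_left fun hbot ↦ hm0 ?_
    rw [hbot, LieSubmodule.mem_bot] at hmem
    exact Subtype.ext hmem
  rwa [isTrivial_iff_max_triv_eq_top (R := K)]

lemma traceForm_nondegenerate_of_not_isTrivial [LieAlgebra.IsSimple K L] [IsIrreducible K L M]
    (h : ¬ IsTrivial L M) : (traceForm K L M).Nondegenerate := by
  refine (traceForm_isSymm K L M).isRefl.nondegenerate_iff_separatingLeft.mpr ?_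
  have hperp (y : L) : y ∈ LieAlgebra.InvariantForm.orthogonal (traceForm K L M)
      (traceForm_lieInvariant K L M) (⊤ : LieIdeal K L) ↔ ∀ x, traceForm K L M x y = 0 := by
    simp [LieAlgebra.InvariantForm.mem_orthogonal]
  intro x hx
  rcases LieAlgebra.IsSimple.eq_bot_or_eq_top (LieAlgebra.InvariantForm.orthogonal
    (traceForm K L M) (traceForm_lieInvariant K L M) (⊤ : LieIdeal K L)) with hbot | htop
  · rw [← LieSubmodule.mem_bot (R := K) (L := L), ← hbot, hperp]
    intro y
    rw [traceForm_comm, hx]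
  · refine (h (isTrivial_of_traceForm_eq_zero (K := K) ?_)).elim
    ext y z
    exact (hperp z).mp (by rw [htop]; exact LieSubmodule.mem_top z) y

lemma bijective_casimir [Fintype ι] [DecidableEq ι] [Nonempty ι] [IsIrreducible K L M]
    {b b' : Basis ι K L}
    (hbb' : ∀ i j, traceForm K L M (b' i) (b j) = if i = j then 1 else 0) :
    Function.Bijective (casimir M b b') := by
  let Ω : M →ₗ⁅K,L⁆ M :=
    { casimir M b b' with map_lie' := casimir_lie (traceForm_lieInvariant K L M) hbb' _ _ }
  have hinj : Function.Injective (casimir M b b') := by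
    change Function.Injective Ω
    rw [← LieModuleHom.ker_eq_bot]
    refine (eq_bot_or_eq_top _).resolve_right fun htop ↦ ?_
    have h₀ : casimir M b b' = 0 := by
      ext m
      exact LieModuleHom.mem_ker.mp (show m ∈ Ω.ker from htop ▸ LieSubmodule.mem_top m)
    have := trace_casimir (M := M) (b := b) (b' := b') (by simp [hbb'])
    rw [h₀, map_zero] at this
    exact Fintype.card_ne_zero (by exact_mod_cast this.symm)
  exact ⟨hinj, LinearMap.surjective_of_injective hinj⟩

/-- **Whitehead's second lemma** for nontrivial irreducible modules over a simple Lie algebra. -/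
theorem exists_coboundary_of_isIrreducible [FiniteDimensional K L] [LieAlgebra.IsSimple K L]
    [IsIrreducible K L M] (hM : ¬ IsTrivial L M) (f : L →ₗ[K] L →ₗ[K] M)
    (hf : ∀ u x y, ⁅u, f x y⁆ =
      ⁅x, f u y⁆ - ⁅y, f u x⁆ + f ⁅u, x⁆ y - f ⁅u, y⁆ x - f u ⁅x, y⁆) :
    ∃ q : L →ₗ[K] M, ∀ x y, f x y = ⁅x, q y⁆ - ⁅y, q x⁆ - q ⁅x, y⁆ := by
  have := LieAlgebra.IsSimple.nontrivial K L
  let b := finBasis K L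
  have hnd := traceForm_nondegenerate_of_not_isTrivial (K := K) hM
  have hbb' (i j) : traceForm K L M ((traceForm K L M).dualBasis hnd b i) (b j) =
      if i = j then 1 else 0 := by
    rw [LinearMap.BilinForm.apply_dualBasis_left]
    simp [eq_comm]
  have : Nonempty (Fin (finrank K L)) := b.index_nonempty
  exact exists_coboundary_of_bijective_casimir (traceForm_lieInvariant K L M) hbb'
    (bijective_casimir hbb') f hf

end LieModule

namespace LieAlgebra

variable {K e g N : Type*} [Field K] [LieRing e] [LieAlgebra K e] [LieRing g] [LieAlgebra K g]
  [AddCommGroup N] [Module K N] [LieRingModule e N] [LieModule K e N]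
  {π : e →ₗ⁅K⁆ g} {s : g →ₗ[K] e}

/-- Given a linear section `s` of `π : e → g`, an `e`-module on which the kernel of `π` acts
trivially is a `g`-module. -/
abbrev ringModuleOfSection (hs : ∀ x, π (s x) = x) (hN : ∀ z, π z = 0 → ∀ n : N, ⁅z, n⁆ = 0) :
    LieRingModule g N where
  bracket x n := ⁅s x, n⁆
  add_lie x y n := by simp
  lie_add x m n := by simp
  leibniz_lie x y n := by
    have h := hN (s ⁅x, y⁆ - ⁅s x, s y⁆) (by simp [hs]) n
    rw [sub_lie, sub_eq_zero] at h
    change ⁅s x, ⁅s y, n⁆⁆ = ⁅s ⁅x, y⁆, n⁆ + ⁅s y, ⁅s x, n⁆⁆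
    rw [h, leibniz_lie]

lemma lieModuleOfSection (hs : ∀ x, π (s x) = x) (hN : ∀ z, π z = 0 → ∀ n : N, ⁅z, n⁆ = 0) :
    letI := ringModuleOfSection hs hN
    LieModule K g N :=
  letI := ringModuleOfSection hs hN
  { smul_lie t x n := by
      change ⁅s (t • x), n⁆ = t • ⁅s x, n⁆
      simp
    lie_smul t x n := by
      change ⁅s x, t • n⁆ = t • ⁅s x, n⁆
      simp }

lemma exists_linear_section (hsurj : Function.Surjective π) :
    ∃ s : g →ₗ[K] e, ∀ x, π (s x) = x := by
  obtain ⟨s, hs⟩ := (π : e →ₗ[K] g).exists_rightInverse_of_surjective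
    (LinearMap.range_eq_top.mpr hsurj)
  exact ⟨s, fun x ↦ LinearMap.congr_fun hs x⟩

/-- Central extensions of a Lie algebra with nondegenerate Killing form split. -/
theorem exists_section_of_ker_central [FiniteDimensional K g] [IsKilling K g]
    (hsurj : Function.Surjective π) (hc : ∀ z, π z = 0 → ∀ x : e, ⁅z, x⁆ = 0) :
    ∃ τ : g →ₗ⁅K⁆ e, ∀ x, π (τ x) = x := by
  obtain ⟨s, hs⟩ := exists_linear_section hsurj
  let _ := ringModuleOfSection hs hc
  have := lieModuleOfSection hs hc
  have hact (x : g) (v : e) : ⁅x, v⁆ = ⁅s x, v⁆ := rfl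
  let b := Module.finBasis K g
  have hnd := IsKilling.killingForm_nondegenerate K g
  let b' := (killingForm K g).dualBasis hnd b
  have hbb' (i j) : killingForm K g (b' i) (b j) = if i = j then 1 else 0 := by
    rw [LinearMap.BilinForm.apply_dualBasis_left]
    simp [eq_comm]
  let Ω : Module.End K e := LieModule.casimir e b b'
  have hΩ (x : g) (v : e) : Ω ⁅s x, v⁆ = ⁅s x, Ω v⁆ :=
    LieModule.casimir_lie (LieModule.traceForm_lieInvariant K g g) hbb' x v
  have hπΩ (v : e) : π (Ω v) = π v := by
    rw [← LieModule.casimir_killingForm hbb' (π v)]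
    simp [Ω, LieModule.casimir_apply, hact, hs]
  have hΩker (z : e) (hz : π z = 0) : Ω z = 0 := by
    have h (x : e) : ⁅x, z⁆ = 0 := by rw [← lie_skew, hc z hz, neg_zero]
    simp [Ω, LieModule.casimir_apply, hact, h]
  refine ⟨{ Ω ∘ₗ s with map_lie' := fun {x y} ↦ ?_ }, fun x ↦ (hπΩ _).trans (hs x)⟩
  change Ω (s ⁅x, y⁆) = ⁅Ω (s x), Ω (s y)⁆
  have h₁ := hΩker (s ⁅x, y⁆ - ⁅s x, s y⁆) (by simp [hs])
  have h₂ := hc (s x - Ω (s x)) (by simp [hπΩ]) (Ω (s y))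
  rw [map_sub, sub_eq_zero] at h₁
  rw [sub_lie, sub_eq_zero] at h₂
  rw [h₁, hΩ, h₂]

variable [CharZero K] [FiniteDimensional K e] [FiniteDimensional K g]

/-- Extensions of a simple Lie algebra by a minimal abelian ideal which is not central split. -/
theorem exists_section_of_ker_minimal_abelian [IsSimple K g] (hsurj : Function.Surjective π)
    (hmin : ∀ I : LieIdeal K e, I ≤ π.ker → I = ⊥ ∨ I = π.ker)
    (hab : ∀ z w, π z = 0 → π w = 0 → ⁅z, w⁆ = 0) (hc : ∃ x z : e, π z = 0 ∧ ⁅x, z⁆ ≠ 0) :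
    ∃ τ : g →ₗ⁅K⁆ e, ∀ x, π (τ x) = x := by
  obtain ⟨s, hs⟩ := exists_linear_section hsurj
  have hN (z : e) (hz : π z = 0) (n : π.ker) : ⁅z, n⁆ = 0 :=
    Subtype.ext (hab z n hz n.2)
  let _ := ringModuleOfSection hs hN
  have := lieModuleOfSection hs hN
  have hact (x : e) (n : π.ker) : ((⁅π x, n⁆ : π.ker) : e) = ⁅x, (n : e)⁆ := by
    have h := hN (s (π x) - x) (by simp [hs]) n
    rw [sub_lie, sub_eq_zero] at h
    exact congrArg Subtype.val h
  have hacts (x : g) (n : π.ker) : ((⁅x, n⁆ : π.ker) : e) = ⁅s x, (n : e)⁆ := rfl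
  obtain ⟨x₀, z₀, hz₀, hxz⟩ := hc
  have : Nontrivial π.ker := by
    refine ⟨⟨z₀, hz₀⟩, 0, fun h ↦ hxz ?_⟩
    rw [show z₀ = 0 from congrArg Subtype.val h, lie_zero]
  have : LieModule.IsIrreducible K g π.ker := by
    refine .mk fun P hP ↦ ?_
    let I : LieIdeal K e :=
      { P.toSubmodule.map π.ker.toSubmodule.subtype with
        lie_mem := by
          rintro x _ ⟨n, hn, rfl⟩
          exact ⟨⁅π x, n⁆, P.lie_mem hn, hact x n⟩ }
    have hmem (n : π.ker) : (n : e) ∈ I ↔ n ∈ P := by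
      refine ⟨?_, fun h ↦ ⟨n, h, rfl⟩⟩
      rintro ⟨m, hm, hmn⟩
      rwa [← Subtype.ext hmn]
    have hle : I ≤ π.ker := by
      rintro _ ⟨n, -, rfl⟩
      exact n.2
    rw [eq_top_iff]
    rintro n -
    rcases hmin I hle with h | h
    · refine (hP ((LieSubmodule.eq_bot_iff _).mpr fun m hm ↦ ?_)).elim
      rw [← hmem, h, LieSubmodule.mem_bot] at hm
      exact Subtype.ext hm
    · rw [← hmem, h]
      exact n.2
  have hnt : ¬ LieModule.IsTrivial g π.ker := fun h ↦ hxz <| by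
    rw [← hact x₀ ⟨z₀, hz₀⟩, LieModule.IsTrivial.trivial]
    rfl
  let f : g →ₗ[K] g →ₗ[K] π.ker :=
    LinearMap.mk₂ K (fun x y ↦ ⟨⁅s x, s y⁆ - s ⁅x, y⁆, by simp [hs]⟩)
      (fun x y z ↦ Subtype.ext <| by simp; abel)
      (fun t x y ↦ Subtype.ext <| by simp [smul_sub])
      (fun x y z ↦ Subtype.ext <| by simp; abel)
      (fun t x y ↦ Subtype.ext <| by simp [smul_sub])
  have hf_apply (x y : g) : (f x y : e) = ⁅s x, s y⁆ - s ⁅x, y⁆ := rfl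
  obtain ⟨q, hq⟩ := LieModule.exists_coboundary_of_isIrreducible (K := K) hnt f fun u x y ↦ by
    refine Subtype.ext ?_
    simp only [hacts, hf_apply, LieSubmodule.coe_add, LieSubmodule.coe_sub, lie_sub]
    rw [leibniz_lie (s u) (s x) (s y), leibniz_lie u x y, map_add, ← lie_skew (s y) ⁅s u, s x⁆,
      ← lie_skew (s y) (s ⁅u, x⁆), ← lie_skew (s ⁅u, y⁆) (s x), ← lie_skew ⁅u, y⁆ x, map_neg]
    abel
  refine ⟨{ s - π.ker.toSubmodule.subtype ∘ₗ q with map_lie' := fun {x y} ↦ ?_ }, fun x ↦ ?_⟩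
  · change s ⁅x, y⁆ - (q ⁅x, y⁆ : e) = ⁅s x - q x, s y - q y⁆
    have h₁ := congrArg Subtype.val (hq x y)
    have h₂ := hab (q x) (q y) (q x).2 (q y).2
    simp only [hacts, hf_apply, LieSubmodule.coe_sub] at h₁
    rw [sub_lie, lie_sub, lie_sub, h₂, ← lie_skew (q x : e) (s y)]
    rw [sub_eq_iff_eq_add] at h₁
    rw [h₁]
    abel
  · change π (s x - q x) = x
    rw [map_sub, hs, show π (q x) = 0 from (q x).2, sub_zero]

end LieAlgebra

namespace LieAlgebra

variable {K e g : Type*} [Field K] [LieRing e] [LieAlgebra K e] [LieRing g] [LieAlgebra K g]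
  {π : e →ₗ⁅K⁆ g}

theorem exists_section_of_finrank_eq_one (hsurj : Function.Surjective π)
    (hg : Module.finrank K g = 1) : ∃ τ : g →ₗ⁅K⁆ e, ∀ x, π (τ x) = x := by
  obtain ⟨s, hs⟩ := exists_linear_section hsurj
  obtain ⟨v, -, hv⟩ := finrank_eq_one_iff'.mp hg
  refine ⟨{ s with map_lie' := fun {x y} ↦ ?_ }, hs⟩
  change s ⁅x, y⁆ = ⁅s x, s y⁆
  obtain ⟨a, rfl⟩ := hv x
  obtain ⟨b, rfl⟩ := hv y
  simp

/-- If the quotient extension by an ideal inside the kernel splits, and extensions restricted to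
smaller subalgebras split, then so does the extension. -/
theorem exists_section_of_quotient (hsurj : Function.Surjective π) {I : LieIdeal K e}
    (hI : I ≤ π.ker) (hI' : I ≠ π.ker)
    (hquot : ∀ ρ : (e ⧸ I) →ₗ⁅K⁆ g, Function.Surjective ρ →
      ∃ τ : g →ₗ⁅K⁆ (e ⧸ I), ∀ x, ρ (τ x) = x)
    (hsub : ∀ (A : LieSubalgebra K e) (ρ : A →ₗ⁅K⁆ g), A ≠ ⊤ → Function.Surjective ρ →
      ∃ τ : g →ₗ⁅K⁆ A, ∀ x, ρ (τ x) = x) :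
    ∃ τ : g →ₗ⁅K⁆ e, ∀ x, π (τ x) = x := by
  let mk : e →ₗ⁅K⁆ (e ⧸ I) :=
    { I.toSubmodule.mkQ with map_lie' := rfl }
  have hmk : Function.Surjective mk := I.toSubmodule.mkQ_surjective
  let ρ : (e ⧸ I) →ₗ⁅K⁆ g :=
    { I.toSubmodule.liftQ (π : e →ₗ[K] g) hI with
      map_lie' := fun {x y} ↦ by
        obtain ⟨x, rfl⟩ := hmk x
        obtain ⟨y, rfl⟩ := hmk y
        exact π.map_lie x y }
  obtain ⟨σ, hσ⟩ := hquot ρ fun x ↦ (hsurj x).imp' mk fun _ h ↦ h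
  let A : LieSubalgebra K e := σ.range.comap mk
  have hA : A ≠ ⊤ := fun h ↦ hI' <| le_antisymm hI fun z hz ↦ by
    obtain ⟨y, hy⟩ : mk z ∈ σ.range := (show z ∈ A from h ▸ LieSubalgebra.mem_top z)
    have hy' : y = 0 := by
      rw [← hσ y]
      exact (congrArg ρ hy).trans hz
    have hz' : mk z = 0 := by
      rw [← hy, hy']
      exact map_zero σ
    exact (Submodule.Quotient.mk_eq_zero _).mp hz'
  obtain ⟨τ, hτ⟩ := hsub A (π.comp A.incl) hA fun x ↦ by
    obtain ⟨y, hy⟩ := hmk (σ x)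
    exact ⟨⟨y, x, hy.symm⟩, (congrArg ρ hy).trans (hσ x)⟩
  exact ⟨A.incl.comp τ, hτ⟩

theorem exists_section_of_isKilling [FiniteDimensional K e] [IsKilling K e]
    (hsurj : Function.Surjective π) : ∃ τ : g →ₗ⁅K⁆ e, ∀ x, π (τ x) = x := by
  have hc := LieIdeal.isCompl_killingCompl π.ker
  set C := π.ker.killingCompl
  have hbij : Function.Bijective (π.comp C.incl) := by
    refine ⟨(injective_iff_map_eq_zero _).mpr fun z hz ↦ Subtype.ext ?_, fun x ↦ ?_⟩
    · have h : (z : e) ∈ π.ker ⊓ C := ⟨hz, z.2⟩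
      rwa [hc.inf_eq_bot, LieSubmodule.mem_bot] at h
    · obtain ⟨y, rfl⟩ := hsurj x
      have hy : y ∈ π.ker ⊔ C := hc.sup_eq_top ▸ LieSubmodule.mem_top y
      obtain ⟨z, hz, w, hw, rfl⟩ := (LieSubmodule.mem_sup _ _ _).mp hy
      refine ⟨⟨w, hw⟩, ?_⟩
      rw [map_add, show π z = 0 from hz, zero_add]
      rfl
  let φ := LieEquiv.ofBijective _ hbij
  exact ⟨C.incl.comp φ.symm.toLieHom, φ.apply_symm_apply⟩

/-- A surjective homomorphism onto a Lie algebra with trivial radical kills the radical. -/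
theorem radical_le_ker [FiniteDimensional K e] [HasTrivialRadical K g]
    (hsurj : Function.Surjective π) : radical K e ≤ π.ker := by
  let J : LieIdeal K g :=
    { (radical K e).toSubmodule.map (π : e →ₗ[K] g) with
      lie_mem := by
        rintro x _ ⟨z, hz, rfl⟩
        obtain ⟨y, rfl⟩ := hsurj x
        exact ⟨⁅y, z⁆, (radical K e).lie_mem hz, π.map_lie y z⟩ }
  let f : radical K e →ₗ⁅K⁆ J :=
    { toFun z := ⟨π z, z, z.2, rfl⟩
      map_add' x y := Subtype.ext (map_add π (x : e) y)
      map_smul' t x := Subtype.ext (map_smul π t (x : e))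
      map_lie' {x y} := Subtype.ext (π.map_lie x y) }
  have hf : Function.Surjective f := by
    rintro ⟨_, z, hz, rfl⟩
    exact ⟨⟨z, hz⟩, rfl⟩
  have : IsSolvable J := hf.lieAlgebra_isSolvable
  have hJ : J = ⊥ := HasTrivialRadical.eq_bot_of_isSolvable J
  intro z hz
  have h : π z ∈ J := ⟨z, hz, rfl⟩
  rwa [hJ, LieSubmodule.mem_bot] at h

/-- A nonzero solvable ideal is not perfect. -/
theorem lie_self_ne_of_isSolvable {I : LieIdeal K e} [IsSolvable I] (hI : I ≠ ⊥) :
    ⁅I, I⁆ ≠ I := fun h ↦ by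
  obtain ⟨k, hk⟩ := IsSolvable.solvable K I
  rw [LieIdeal.derivedSeries_eq_bot_iff] at hk
  exact hI ((Function.iterate_fixed (f := fun J : LieIdeal K e ↦ ⁅J, J⁆) h k).symm.trans hk)

/-- **Levi's theorem** for simple quotients: every finite-dimensional extension of a simple Lie
algebra in characteristic zero splits. -/
theorem exists_section_of_isSimple [CharZero K] [FiniteDimensional K e] [FiniteDimensional K g]
    [IsSimple K g] (hsurj : Function.Surjective π) :
    ∃ τ : g →ₗ⁅K⁆ e, ∀ x, π (τ x) = x := by
  induction hn : Module.finrank K e using Nat.strong_induction_on generalizing e with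
  | _ n ih
  subst hn
  by_cases hc : ∀ z, π z = 0 → ∀ x : e, ⁅z, x⁆ = 0
  · exact exists_section_of_ker_central hsurj hc
  push Not at hc
  obtain ⟨z₀, hz₀, x₀, hzx⟩ := hc
  by_cases hmin : ∀ I : LieIdeal K e, I ≤ π.ker → I = ⊥ ∨ I = π.ker
  · have hker : π.ker ≠ ⊥ := fun h ↦ hzx <| by
      have : z₀ ∈ π.ker := hz₀
      rw [h, LieSubmodule.mem_bot] at this
      rw [this, zero_lie]
    rcases hmin _ (radical_le_ker hsurj) with h | h
    · have : HasTrivialRadical K e := ⟨h⟩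
      exact exists_section_of_isKilling hsurj
    · have : IsSolvable π.ker := (LieIdeal.solvable_iff_le_radical K e _).mpr h.ge
      have hlie := (hmin ⁅π.ker, π.ker⁆ (LieSubmodule.lie_le_left _ _)).resolve_right
        (lie_self_ne_of_isSolvable hker)
      refine exists_section_of_ker_minimal_abelian hsurj hmin (fun z w hz hw ↦ ?_)
        ⟨x₀, z₀, hz₀, fun h ↦ hzx ?_⟩
      · have := LieSubmodule.lie_mem_lie (I := π.ker) (N := π.ker) hz hw
        rwa [hlie, LieSubmodule.mem_bot] at this
      · rw [← lie_skew, h, neg_zero]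
  · push Not at hmin
    obtain ⟨I, hle, hbot, hne⟩ := hmin
    refine exists_section_of_quotient hsurj hle hne (fun ρ hρ ↦ ?_) fun A ρ hA hρ ↦ ?_
    · refine ih _ ?_ hρ rfl
      have hq := I.toSubmodule.finrank_quotient_add_finrank
      have : Nontrivial I := (LieSubmodule.nontrivial_iff_ne_bot K e e).mpr hbot
      have hI : 0 < Module.finrank K I.toSubmodule := Module.finrank_pos (R := K) (M := I)
      change Module.finrank K (e ⧸ I.toSubmodule) < _
      omega
    · exact ih _ (Submodule.finrank_lt (by simpa using hA)) hρ rfl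

end LieAlgebra

/-- A short exact sequence of finite-dimensional real Lie algebras
`0 → h → e → g → 0` splits whenever `g` is simple or one-dimensional. -/
theorem extension_by_simple_or_one_dimensional_splits
    (e g : Type*) [LieRing e] [LieAlgebra ℝ e] [LieRing g] [LieAlgebra ℝ g]
    [FiniteDimensional ℝ e] [FiniteDimensional ℝ g]
    (h : LieIdeal ℝ e)
    (π : e →ₗ⁅ℝ⁆ g)
    (hsurj : Function.Surjective π)
    (hker : ∀ x : e, x ∈ h ↔ π x = 0)
    (hg : LieAlgebra.IsSimple ℝ g ∨ Module.finrank ℝ g = 1) :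
    ∃ τ : g →ₗ⁅ℝ⁆ e, ∀ x : g, π (τ x) = x := by
  rcases hg with _ | hg
  · exact LieAlgebra.exists_section_of_isSimple hsurj
  · exact LieAlgebra.exists_section_of_finrank_eq_one hsurj hg
end

section
/- The Extended Bargmann algebra ebarg — the eight-dimensional real vector space with basis {J, H, G₁, G₂, P₁, P₂, J*, H*} and brackets [J,G_a] = ε_{am}G_m, [J,P_a] = ε_{am}P_m, [G_a,H] = −ε_{am}P_m, [G_a,G_b] = ε_{ab}H*, [G_a,P_b] = ε_{ab}J*, with J* and H* central and all other brackets zero — is a Lie algebra, and for every real μ⁻ ≠ 0 the symmetric bilinear form with nonvanishing entries ⟨P_a,G_b⟩ = μ⁻δ_{ab}, ⟨J,J*⟩ = μ⁻, ⟨H,H*⟩ = μ⁻ is an invariant metric on ebarg (symmetric, invariant, nondegenerate). -/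
namespace ExtendedBargmann

/-- Basis index type for the Extended Bargmann algebra:
`J, H, G_a, P_a (a ∈ {1,2}), J*, H*`. -/
inductive Idx : Type
  | J : Idx
  | H : Idx
  | G : Fin 2 → Idx
  | P : Fin 2 → Idx
  | Js : Idx
  | Hs : Idx
  deriving DecidableEq, Fintype

/-- The antisymmetric ε-symbol, `ε₁₂ = 1`. -/
def eps (a b : Fin 2) : ℝ := if a = b then 0 else if a = 0 then 1 else -1

/-- Kronecker delta. -/
def kd (a b : Fin 2) : ℝ := if a = b then 1 else 0

/-- The underlying 8-dimensional real vector space of the Extended Bargmann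
algebra, in coordinates with respect to the basis `Idx`. -/
abbrev V : Type := Idx → ℝ

/-- Basis vectors. -/
def e (i : Idx) : V := fun j => if j = i then 1 else 0

/-- Structure constants of the Extended Bargmann algebra:
`[J,G_a] = ε_{am} G_m`, `[J,P_a] = ε_{am} P_m`, `[G_a,H] = −ε_{am} P_m`,
`[G_a,G_b] = ε_{ab} H*`, `[G_a,P_b] = ε_{ab} J*`, with `J*`, `H*` central and all
other brackets zero. -/
noncomputable def c : Idx → Idx → V
  | .J, .G a => ∑ m, eps a m • e (.G m)
  | .G a, .J => -(∑ m, eps a m • e (.G m))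
  | .J, .P a => ∑ m, eps a m • e (.P m)
  | .P a, .J => -(∑ m, eps a m • e (.P m))
  | .G a, .H => -(∑ m, eps a m • e (.P m))
  | .H, .G a => ∑ m, eps a m • e (.P m)
  | .G a, .G b => eps a b • e .Hs
  | .G a, .P b => eps a b • e .Js
  | .P a, .G b => eps a b • e .Js
  | _, _ => 0

/-- The bilinear bracket extending the structure constants. -/
noncomputable def br (x y : V) : V := ∑ i, ∑ j, (x i * y j) • c i j

/-- Matrix of the candidate invariant metric: nonvanishing entries
`⟨P_a,G_b⟩ = μ⁻ δ_{ab}`, `⟨J,J*⟩ = μ⁻`, `⟨H,H*⟩ = μ⁻`. -/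
noncomputable def M (μ : ℝ) : Idx → Idx → ℝ
  | .P a, .G b => μ * kd a b
  | .G a, .P b => μ * kd a b
  | .J, .Js => μ
  | .Js, .J => μ
  | .H, .Hs => μ
  | .Hs, .H => μ
  | _, _ => 0

/-- The corresponding bilinear form. -/
noncomputable def B (μ : ℝ) (x y : V) : ℝ := ∑ i, ∑ j, x i * y j * M μ i j

/-- A sum over the basis indices, written out. -/
theorem sum_idx {A : Type*} [AddCommMonoid A] (f : Idx → A) :
    ∑ i, f i = f .J + f .H + f (.G 0) + f (.G 1) + f (.P 0) + f (.P 1) + f .Js + f .Hs := by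
  have h : (Finset.univ : Finset Idx) = {.J, .H, .G 0, .G 1, .P 0, .P 1, .Js, .Hs} := by decide
  rw [h]
  simp [Finset.sum_insert, add_assoc]

theorem br_J (x y : V) : br x y .J = 0 := by
  simp [br, sum_idx, c, e, eps]

theorem br_H (x y : V) : br x y .H = 0 := by
  simp [br, sum_idx, c, e, eps]

theorem br_G (x y : V) (a : Fin 2) :
    br x y (.G a) = ∑ m, eps m a * (x .J * y (.G m) - x (.G m) * y .J) := by
  fin_cases a <;> simp [br, sum_idx, c, e, eps] <;> ring

theorem br_P (x y : V) (a : Fin 2) :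
    br x y (.P a) = ∑ m, eps m a * (x .J * y (.P m) - x (.P m) * y .J
      + x .H * y (.G m) - x (.G m) * y .H) := by
  fin_cases a <;> simp [br, sum_idx, c, e, eps] <;> ring

theorem br_Js (x y : V) :
    br x y .Js = x (.G 0) * y (.P 1) - x (.G 1) * y (.P 0)
      + x (.P 0) * y (.G 1) - x (.P 1) * y (.G 0) := by
  simp [br, sum_idx, c, e, eps]; ring

theorem br_Hs (x y : V) :
    br x y .Hs = x (.G 0) * y (.G 1) - x (.G 1) * y (.G 0) := by
  simp [br, sum_idx, c, e, eps]; ring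

theorem B_eq (μ : ℝ) (x y : V) :
    B μ x y = μ * (x .J * y .Js + x .Js * y .J + x .H * y .Hs + x .Hs * y .H
      + ∑ a, (x (.P a) * y (.G a) + x (.G a) * y (.P a))) := by
  simp [B, sum_idx, M, kd]; ring

/-- the Extended Bargmann brackets define a Lie algebra
(skew-symmetry and the Jacobi identity hold), and for every `μ⁻ ≠ 0` the bilinear
form with nonvanishing entries `⟨P_a,G_b⟩ = μ⁻δ_{ab}`, `⟨J,J*⟩ = μ⁻`,
`⟨H,H*⟩ = μ⁻` is an invariant metric (symmetric, invariant, nondegenerate). -/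
theorem extended_bargmann_lie_algebra_and_invariant_metric (μ : ℝ) (hμ : μ ≠ 0) :
    (∀ x y : V, br x y = -br y x) ∧
    (∀ x y z : V, br x (br y z) + br z (br x y) + br y (br z x) = 0) ∧
    (∀ x y : V, B μ x y = B μ y x) ∧
    (∀ z x y : V, B μ (br z x) y + B μ x (br z y) = 0) ∧
    (∀ x : V, (∀ y : V, B μ x y = 0) → x = 0) := by
  refine ⟨fun x y => ?_, fun x y z => ?_, fun x y => ?_, fun z x y => ?_, fun x hx => ?_⟩
  · ext (_ | _ | a | a | _ | _) <;> try fin_cases a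
    all_goals
      simp [br_J, br_H, br_G, br_P, br_Js, br_Hs, eps]
      try ring
  · ext (_ | _ | a | a | _ | _) <;> try fin_cases a
    all_goals
      simp [br_J, br_H, br_G, br_P, br_Js, br_Hs, eps]
      try ring
  · simp only [B_eq, Fin.sum_univ_two]
    ring
  · simp [B_eq, br_J, br_H, br_G, br_P, br_Js, br_Hs, eps]
    ring
  · ext (_ | _ | a | a | _ | _)
    · simpa [B_eq, e, hμ] using hx (e .Js)
    · simpa [B_eq, e, hμ] using hx (e .Hs)
    · simpa [B_eq, e, hμ] using hx (e (.P a))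
    · simpa [B_eq, e, hμ] using hx (e (.G a))
    · simpa [B_eq, e, hμ] using hx (e .J)
    · simpa [B_eq, e, hμ] using hx (e .H)

end ExtendedBargmann
end

section
/- The spin-3 Carroll algebra hs₃car1 — the 16-dimensional real vector space with basis {J, H, G_a, P_a, J_a, H_a, G_{ab} = G_{ba}, P_{ab} = P_{ba} : a,b ∈ {1,2}} and nonvanishing brackets [J,G_a] = ε_{am}G_m; [J,P_a] = ε_{am}P_m; [G_a,P_b] = −ε_{ab}H; [J,J_a] = ε_{am}J_m; [J,G_{ab}] = −ε_{m(a}G_{b)m}; [J,H_a] = ε_{am}H_m; [J,P_{ab}] = −ε_{m(a}P_{b)m}; [G_a,J_b] = −(ε_{am}G_{bm} + ε_{ab}G_{mm}); [G_a,P_{bc}] = −ε_{a(b}H_{c)}; [H,J_a] = ε_{am}H_m; [P_a,J_b] = −(ε_{am}P_{bm} + ε_{ab}P_{mm}); [P_a,G_{bc}] = −ε_{a(b}H_{c)}; [J_a,J_b] = ε_{ab}J; [J_a,G_{bc}] = δ_{a(b}ε_{c)m}G_m; [J_a,H_b] = ε_{ab}H; [J_a,P_{bc}] = δ_{a(b}ε_{c)m}P_m;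 [G_{ab},P_{cd}] = δ_{(a(c}ε_{d)b)}H — is a Lie algebra (the brackets satisfy the Jacobi identity), and the symmetric bilinear form with nonvanishing entries ⟨H,J⟩ = −1, ⟨P_a,G_b⟩ = δ_{ab}, ⟨H_a,J_b⟩ = −δ_{ab}, ⟨P_{ab},G_{cd}⟩ = δ_{a(c}δ_{d)b} − (2/3)δ_{ab}δ_{cd} is an invariant metric on hs₃car1 (symmetric, invariant, nondegenerate). -/
namespace HS3Car1

/-- Basis index type for the spin-3 Carroll algebra `hs₃car1`:
`J, H, G_a, P_a, J_a, H_a` and the symmetric pairs `G_{ab}`, `P_{ab}` (three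
independent components each, encoded by `Fin 3` via `0 ↦ (1,1)`, `1 ↦ (1,2)`,
`2 ↦ (2,2)`). -/
inductive Idx : Type
  | J : Idx
  | H : Idx
  | G : Fin 2 → Idx
  | P : Fin 2 → Idx
  | JJ : Fin 2 → Idx
  | HH : Fin 2 → Idx
  | GG : Fin 3 → Idx
  | PP : Fin 3 → Idx
  deriving DecidableEq, Fintype

/-- The antisymmetric ε-symbol, `ε₁₂ = 1`. -/
def eps (a b : Fin 2) : ℝ := if a = b then 0 else if a = 0 then 1 else -1

/-- Kronecker delta. -/
def kd (a b : Fin 2) : ℝ := if a = b then 1 else 0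

/-- Encoding of a symmetric pair of indices. -/
def sidx (a b : Fin 2) : Fin 3 :=
  if a = 0 then (if b = 0 then 0 else 1) else (if b = 0 then 1 else 2)

/-- Representative pair of a symmetric-pair index. -/
def fidx : Fin 3 → Fin 2 × Fin 2 := ![(0, 0), (0, 1), (1, 1)]

/-- The underlying 16-dimensional real vector space, in coordinates. -/
abbrev V : Type := Idx → ℝ

/-- Basis vectors. -/
def e (i : Idx) : V := fun j => if j = i then 1 else 0

def vJ : V := e .J
def vH : V := e .H
def vG (a : Fin 2) : V := e (.G a)
def vP (a : Fin 2) : V := e (.P a)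
def vJJ (a : Fin 2) : V := e (.JJ a)
def vHH (a : Fin 2) : V := e (.HH a)
/-- `G_{ab}` (symmetric in `a b`). -/
def vGG (a b : Fin 2) : V := e (.GG (sidx a b))
/-- `P_{ab}` (symmetric in `a b`). -/
def vPP (a b : Fin 2) : V := e (.PP (sidx a b))

/- Bracket value helpers (each is the listed right-hand side). -/
noncomputable def cJG (a : Fin 2) : V := ∑ m, eps a m • vG m
noncomputable def cJP (a : Fin 2) : V := ∑ m, eps a m • vP m
noncomputable def cJJJ (a : Fin 2) : V := ∑ m, eps a m • vJJ m
noncomputable def cJHH (a : Fin 2) : V := ∑ m, eps a m • vHH m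
/-- `[J, G_{ab}] = −ε_{m(a} G_{b)m}`. -/
noncomputable def cJGG (a b : Fin 2) : V :=
  -((∑ m, eps m a • vGG b m) + (∑ m, eps m b • vGG a m))
/-- `[J, P_{ab}] = −ε_{m(a} P_{b)m}`. -/
noncomputable def cJPP (a b : Fin 2) : V :=
  -((∑ m, eps m a • vPP b m) + (∑ m, eps m b • vPP a m))
/-- `[G_a, J_b] = −(ε_{am} G_{bm} + ε_{ab} G_{mm})`. -/
noncomputable def cGJJ (a b : Fin 2) : V :=
  -((∑ m, eps a m • vGG b m) + eps a b • (∑ m, vGG m m))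
/-- `[P_a, J_b] = −(ε_{am} P_{bm} + ε_{ab} P_{mm})`. -/
noncomputable def cPJJ (a b : Fin 2) : V :=
  -((∑ m, eps a m • vPP b m) + eps a b • (∑ m, vPP m m))
/-- `[G_a, P_{bc}] = −ε_{a(b} H_{c)}` (also `[P_a, G_{bc}]`). -/
noncomputable def cGPP (a b c : Fin 2) : V := -(eps a b • vHH c + eps a c • vHH b)
/-- `[J_a, G_{bc}] = δ_{a(b} ε_{c)m} G_m`. -/
noncomputable def cJJGG (a b c : Fin 2) : V :=
  ∑ m, (kd a b * eps c m + kd a c * eps b m) • vG m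
/-- `[J_a, P_{bc}] = δ_{a(b} ε_{c)m} P_m`. -/
noncomputable def cJJPP (a b c : Fin 2) : V :=
  ∑ m, (kd a b * eps c m + kd a c * eps b m) • vP m
/-- `δ_{(a(c} ε_{d)b)}` (no normalization in the symmetrizations). -/
def symDE (a b c d : Fin 2) : ℝ :=
  kd a c * eps d b + kd a d * eps c b + kd b c * eps d a + kd b d * eps c a

/-- Structure constants of `hs₃car1`, exactly the brackets listed in the
statement (all pairs not listed, and not obtained by antisymmetry, vanish). -/
noncomputable def c : Idx → Idx → V
  | .J, .G a => cJG a
  | .G a, .J => -cJG a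
  | .J, .P a => cJP a
  | .P a, .J => -cJP a
  | .G a, .P b => -(eps a b) • vH
  | .P a, .G b => eps b a • vH
  | .J, .JJ a => cJJJ a
  | .JJ a, .J => -cJJJ a
  | .J, .GG s => cJGG (fidx s).1 (fidx s).2
  | .GG s, .J => -cJGG (fidx s).1 (fidx s).2
  | .J, .HH a => cJHH a
  | .HH a, .J => -cJHH a
  | .J, .PP s => cJPP (fidx s).1 (fidx s).2
  | .PP s, .J => -cJPP (fidx s).1 (fidx s).2
  | .G a, .JJ b => cGJJ a b
  | .JJ b, .G a => -cGJJ a b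
  | .G a, .PP s => cGPP a (fidx s).1 (fidx s).2
  | .PP s, .G a => -cGPP a (fidx s).1 (fidx s).2
  | .H, .JJ a => cJHH a
  | .JJ a, .H => -cJHH a
  | .P a, .JJ b => cPJJ a b
  | .JJ b, .P a => -cPJJ a b
  | .P a, .GG s => cGPP a (fidx s).1 (fidx s).2
  | .GG s, .P a => -cGPP a (fidx s).1 (fidx s).2
  | .JJ a, .JJ b => eps a b • vJ
  | .JJ a, .GG s => cJJGG a (fidx s).1 (fidx s).2
  | .GG s, .JJ a => -cJJGG a (fidx s).1 (fidx s).2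
  | .JJ a, .HH b => eps a b • vH
  | .HH a, .JJ b => eps a b • vH
  | .JJ a, .PP s => cJJPP a (fidx s).1 (fidx s).2
  | .PP s, .JJ a => -cJJPP a (fidx s).1 (fidx s).2
  | .GG s, .PP t => symDE (fidx s).1 (fidx s).2 (fidx t).1 (fidx t).2 • vH
  | .PP t, .GG s => -(symDE (fidx s).1 (fidx s).2 (fidx t).1 (fidx t).2) • vH
  | _, _ => 0

/-- The bilinear bracket extending the structure constants. -/
noncomputable def br (x y : V) : V := ∑ i, ∑ j, (x i * y j) • c i j

/-- `⟨P_{ab}, G_{cd}⟩ = δ_{a(c} δ_{d)b} − (2/3) δ_{ab} δ_{cd}`. -/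
noncomputable def mq (s t : Fin 3) : ℝ :=
  kd (fidx s).1 (fidx t).1 * kd (fidx t).2 (fidx s).2
    + kd (fidx s).1 (fidx t).2 * kd (fidx t).1 (fidx s).2
    - (2 / 3) * (kd (fidx s).1 (fidx s).2 * kd (fidx t).1 (fidx t).2)

/-- Matrix of the candidate invariant metric of `hs₃car1`: nonvanishing entries
`⟨H,J⟩ = −1`, `⟨P_a,G_b⟩ = δ_{ab}`, `⟨H_a,J_b⟩ = −δ_{ab}`,
`⟨P_{ab},G_{cd}⟩ = δ_{a(c}δ_{d)b} − (2/3)δ_{ab}δ_{cd}`. -/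
noncomputable def M : Idx → Idx → ℝ
  | .H, .J => -1
  | .J, .H => -1
  | .P a, .G b => kd a b
  | .G a, .P b => kd a b
  | .HH a, .JJ b => -(kd a b)
  | .JJ a, .HH b => -(kd a b)
  | .PP s, .GG t => mq s t
  | .GG s, .PP t => mq t s
  | _, _ => 0

/-- The corresponding bilinear form. -/
noncomputable def B (x y : V) : ℝ := ∑ i, ∑ j, x i * y j * M i j

theorem sum_idx {A : Type*} [AddCommMonoid A] (f : Idx → A) :
    ∑ i, f i = f .J + f .H + ∑ a, f (.G a) + ∑ a, f (.P a) + ∑ a, f (.JJ a) + ∑ a, f (.HH a)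
      + ∑ s, f (.GG s) + ∑ s, f (.PP s) := by
  have h : (Finset.univ : Finset Idx) =
      {.J, .H, .G 0, .G 1, .P 0, .P 1, .JJ 0, .JJ 1, .HH 0, .HH 1,
        .GG 0, .GG 1, .GG 2, .PP 0, .PP 1, .PP 2} := by decide
  simp [h, Fin.sum_univ_two, Fin.sum_univ_three, add_assoc]

theorem forall_idx {p : Idx → Prop} :
    (∀ i, p i) ↔ p .J ∧ p .H ∧ (∀ a, p (.G a)) ∧ (∀ a, p (.P a)) ∧ (∀ a, p (.JJ a)) ∧
      (∀ a, p (.HH a)) ∧ (∀ s, p (.GG s)) ∧ ∀ s, p (.PP s) :=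
  ⟨fun h => ⟨h _, h _, fun _ => h _, fun _ => h _, fun _ => h _, fun _ => h _, fun _ => h _,
    fun _ => h _⟩, fun ⟨h₁, h₂, h₃, h₄, h₅, h₆, h₇, h₈⟩ i => by cases i <;> apply_assumption⟩

theorem br_apply_J (x y : V) : br x y .J =
      (x (.JJ 0) * y (.JJ 1) - x (.JJ 1) * y (.JJ 0)) := by
  simp [br, c, sum_idx, Fin.sum_univ_two, Fin.sum_univ_three, cJG, cJP, cJJJ, cJHH, cJGG, cJPP,
    cGJJ, cPJJ, cGPP, cJJGG, cJJPP, symDE, eps, kd, fidx, sidx, vJ, vH, vG, vP, vJJ, vHH, vGG, vPP, e]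
  ring

theorem br_apply_H (x y : V) : br x y .H =
      -(x (.G 0) * y (.P 1) - x (.P 1) * y (.G 0))
      + (x (.G 1) * y (.P 0) - x (.P 0) * y (.G 1))
      + (x (.JJ 0) * y (.HH 1) - x (.HH 1) * y (.JJ 0))
      - (x (.JJ 1) * y (.HH 0) - x (.HH 0) * y (.JJ 1))
      - 2 * (x (.GG 0) * y (.PP 1) - x (.PP 1) * y (.GG 0))
      + 2 * (x (.GG 1) * y (.PP 0) - x (.PP 0) * y (.GG 1))
      - 2 * (x (.GG 1) * y (.PP 2) - x (.PP 2) * y (.GG 1))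
      + 2 * (x (.GG 2) * y (.PP 1) - x (.PP 1) * y (.GG 2)) := by
  simp [br, c, sum_idx, Fin.sum_univ_two, Fin.sum_univ_three, cJG, cJP, cJJJ, cJHH, cJGG, cJPP,
    cGJJ, cPJJ, cGPP, cJJGG, cJJPP, symDE, eps, kd, fidx, sidx, vJ, vH, vG, vP, vJJ, vHH, vGG, vPP, e]
  ring

theorem br_apply_G_0 (x y : V) : br x y (.G 0) =
      -(x .J * y (.G 1) - x (.G 1) * y .J)
      - (x (.JJ 0) * y (.GG 1) - x (.GG 1) * y (.JJ 0))
      - 2 * (x (.JJ 1) * y (.GG 2) - x (.GG 2) * y (.JJ 1)) := by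
  simp [br, c, sum_idx, Fin.sum_univ_two, Fin.sum_univ_three, cJG, cJP, cJJJ, cJHH, cJGG, cJPP,
    cGJJ, cPJJ, cGPP, cJJGG, cJJPP, symDE, eps, kd, fidx, sidx, vJ, vH, vG, vP, vJJ, vHH, vGG, vPP, e]
  ring

theorem br_apply_G_1 (x y : V) : br x y (.G 1) =
      (x .J * y (.G 0) - x (.G 0) * y .J)
      + 2 * (x (.JJ 0) * y (.GG 0) - x (.GG 0) * y (.JJ 0))
      + (x (.JJ 1) * y (.GG 1) - x (.GG 1) * y (.JJ 1)) := by
  simp [br, c, sum_idx, Fin.sum_univ_two, Fin.sum_univ_three, cJG, cJP, cJJJ, cJHH, cJGG, cJPP,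
    cGJJ, cPJJ, cGPP, cJJGG, cJJPP, symDE, eps, kd, fidx, sidx, vJ, vH, vG, vP, vJJ, vHH, vGG, vPP, e]
  ring

theorem br_apply_P_0 (x y : V) : br x y (.P 0) =
      -(x .J * y (.P 1) - x (.P 1) * y .J)
      - (x (.JJ 0) * y (.PP 1) - x (.PP 1) * y (.JJ 0))
      - 2 * (x (.JJ 1) * y (.PP 2) - x (.PP 2) * y (.JJ 1)) := by
  simp [br, c, sum_idx, Fin.sum_univ_two, Fin.sum_univ_three, cJG, cJP, cJJJ, cJHH, cJGG, cJPP,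
    cGJJ, cPJJ, cGPP, cJJGG, cJJPP, symDE, eps, kd, fidx, sidx, vJ, vH, vG, vP, vJJ, vHH, vGG, vPP, e]
  ring

theorem br_apply_P_1 (x y : V) : br x y (.P 1) =
      (x .J * y (.P 0) - x (.P 0) * y .J)
      + 2 * (x (.JJ 0) * y (.PP 0) - x (.PP 0) * y (.JJ 0))
      + (x (.JJ 1) * y (.PP 1) - x (.PP 1) * y (.JJ 1)) := by
  simp [br, c, sum_idx, Fin.sum_univ_two, Fin.sum_univ_three, cJG, cJP, cJJJ, cJHH, cJGG, cJPP,
    cGJJ, cPJJ, cGPP, cJJGG, cJJPP, symDE, eps, kd, fidx, sidx, vJ, vH, vG, vP, vJJ, vHH, vGG, vPP, e]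
  ring

theorem br_apply_JJ_0 (x y : V) : br x y (.JJ 0) =
      -(x .J * y (.JJ 1) - x (.JJ 1) * y .J) := by
  simp [br, c, sum_idx, Fin.sum_univ_two, Fin.sum_univ_three, cJG, cJP, cJJJ, cJHH, cJGG, cJPP,
    cGJJ, cPJJ, cGPP, cJJGG, cJJPP, symDE, eps, kd, fidx, sidx, vJ, vH, vG, vP, vJJ, vHH, vGG, vPP, e]
  ring

theorem br_apply_JJ_1 (x y : V) : br x y (.JJ 1) =
      (x .J * y (.JJ 0) - x (.JJ 0) * y .J) := by
  simp [br, c, sum_idx, Fin.sum_univ_two, Fin.sum_univ_three, cJG, cJP, cJJJ, cJHH, cJGG, cJPP,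
    cGJJ, cPJJ, cGPP, cJJGG, cJJPP, symDE, eps, kd, fidx, sidx, vJ, vH, vG, vP, vJJ, vHH, vGG, vPP, e]
  ring

theorem br_apply_HH_0 (x y : V) : br x y (.HH 0) =
      -(x .J * y (.HH 1) - x (.HH 1) * y .J)
      - (x .H * y (.JJ 1) - x (.JJ 1) * y .H)
      - (x (.G 0) * y (.PP 1) - x (.PP 1) * y (.G 0))
      + 2 * (x (.G 1) * y (.PP 0) - x (.PP 0) * y (.G 1))
      - (x (.P 0) * y (.GG 1) - x (.GG 1) * y (.P 0))
      + 2 * (x (.P 1) * y (.GG 0) - x (.GG 0) * y (.P 1)) := by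
  simp [br, c, sum_idx, Fin.sum_univ_two, Fin.sum_univ_three, cJG, cJP, cJJJ, cJHH, cJGG, cJPP,
    cGJJ, cPJJ, cGPP, cJJGG, cJJPP, symDE, eps, kd, fidx, sidx, vJ, vH, vG, vP, vJJ, vHH, vGG, vPP, e]
  ring

theorem br_apply_HH_1 (x y : V) : br x y (.HH 1) =
      (x .J * y (.HH 0) - x (.HH 0) * y .J)
      + (x .H * y (.JJ 0) - x (.JJ 0) * y .H)
      - 2 * (x (.G 0) * y (.PP 2) - x (.PP 2) * y (.G 0))
      + (x (.G 1) * y (.PP 1) - x (.PP 1) * y (.G 1))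
      - 2 * (x (.P 0) * y (.GG 2) - x (.GG 2) * y (.P 0))
      + (x (.P 1) * y (.GG 1) - x (.GG 1) * y (.P 1)) := by
  simp [br, c, sum_idx, Fin.sum_univ_two, Fin.sum_univ_three, cJG, cJP, cJJJ, cJHH, cJGG, cJPP,
    cGJJ, cPJJ, cGPP, cJJGG, cJJPP, symDE, eps, kd, fidx, sidx, vJ, vH, vG, vP, vJJ, vHH, vGG, vPP, e]
  ring

theorem br_apply_GG_0 (x y : V) : br x y (.GG 0) =
      -(x .J * y (.GG 1) - x (.GG 1) * y .J)
      - (x (.G 0) * y (.JJ 1) - x (.JJ 1) * y (.G 0))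
      + 2 * (x (.G 1) * y (.JJ 0) - x (.JJ 0) * y (.G 1)) := by
  simp [br, c, sum_idx, Fin.sum_univ_two, Fin.sum_univ_three, cJG, cJP, cJJJ, cJHH, cJGG, cJPP,
    cGJJ, cPJJ, cGPP, cJJGG, cJJPP, symDE, eps, kd, fidx, sidx, vJ, vH, vG, vP, vJJ, vHH, vGG, vPP, e]
  ring

theorem br_apply_GG_1 (x y : V) : br x y (.GG 1) =
      2 * (x .J * y (.GG 0) - x (.GG 0) * y .J)
      - 2 * (x .J * y (.GG 2) - x (.GG 2) * y .J)
      - (x (.G 0) * y (.JJ 0) - x (.JJ 0) * y (.G 0))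
      + (x (.G 1) * y (.JJ 1) - x (.JJ 1) * y (.G 1)) := by
  simp [br, c, sum_idx, Fin.sum_univ_two, Fin.sum_univ_three, cJG, cJP, cJJJ, cJHH, cJGG, cJPP,
    cGJJ, cPJJ, cGPP, cJJGG, cJJPP, symDE, eps, kd, fidx, sidx, vJ, vH, vG, vP, vJJ, vHH, vGG, vPP, e]
  ring

theorem br_apply_GG_2 (x y : V) : br x y (.GG 2) =
      (x .J * y (.GG 1) - x (.GG 1) * y .J)
      - 2 * (x (.G 0) * y (.JJ 1) - x (.JJ 1) * y (.G 0))
      + (x (.G 1) * y (.JJ 0) - x (.JJ 0) * y (.G 1)) := by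
  simp [br, c, sum_idx, Fin.sum_univ_two, Fin.sum_univ_three, cJG, cJP, cJJJ, cJHH, cJGG, cJPP,
    cGJJ, cPJJ, cGPP, cJJGG, cJJPP, symDE, eps, kd, fidx, sidx, vJ, vH, vG, vP, vJJ, vHH, vGG, vPP, e]
  ring

theorem br_apply_PP_0 (x y : V) : br x y (.PP 0) =
      -(x .J * y (.PP 1) - x (.PP 1) * y .J)
      - (x (.P 0) * y (.JJ 1) - x (.JJ 1) * y (.P 0))
      + 2 * (x (.P 1) * y (.JJ 0) - x (.JJ 0) * y (.P 1)) := by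
  simp [br, c, sum_idx, Fin.sum_univ_two, Fin.sum_univ_three, cJG, cJP, cJJJ, cJHH, cJGG, cJPP,
    cGJJ, cPJJ, cGPP, cJJGG, cJJPP, symDE, eps, kd, fidx, sidx, vJ, vH, vG, vP, vJJ, vHH, vGG, vPP, e]
  ring

theorem br_apply_PP_1 (x y : V) : br x y (.PP 1) =
      2 * (x .J * y (.PP 0) - x (.PP 0) * y .J)
      - 2 * (x .J * y (.PP 2) - x (.PP 2) * y .J)
      - (x (.P 0) * y (.JJ 0) - x (.JJ 0) * y (.P 0))
      + (x (.P 1) * y (.JJ 1) - x (.JJ 1) * y (.P 1)) := by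
  simp [br, c, sum_idx, Fin.sum_univ_two, Fin.sum_univ_three, cJG, cJP, cJJJ, cJHH, cJGG, cJPP,
    cGJJ, cPJJ, cGPP, cJJGG, cJJPP, symDE, eps, kd, fidx, sidx, vJ, vH, vG, vP, vJJ, vHH, vGG, vPP, e]
  ring

theorem br_apply_PP_2 (x y : V) : br x y (.PP 2) =
      (x .J * y (.PP 1) - x (.PP 1) * y .J)
      - 2 * (x (.P 0) * y (.JJ 1) - x (.JJ 1) * y (.P 0))
      + (x (.P 1) * y (.JJ 0) - x (.JJ 0) * y (.P 1)) := by
  simp [br, c, sum_idx, Fin.sum_univ_two, Fin.sum_univ_three, cJG, cJP, cJJJ, cJHH, cJGG, cJPP,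
    cGJJ, cPJJ, cGPP, cJJGG, cJJPP, symDE, eps, kd, fidx, sidx, vJ, vH, vG, vP, vJJ, vHH, vGG, vPP, e]
  ring

theorem B_eq (x y : V) : B x y =
    -(x .H * y .J + x .J * y .H)
      + (x (.P 0) * y (.G 0) + x (.G 0) * y (.P 0)) + (x (.P 1) * y (.G 1) + x (.G 1) * y (.P 1))
      - (x (.HH 0) * y (.JJ 0) + x (.JJ 0) * y (.HH 0))
      - (x (.HH 1) * y (.JJ 1) + x (.JJ 1) * y (.HH 1))
      + 4 / 3 * (x (.PP 0) * y (.GG 0) + x (.GG 0) * y (.PP 0))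
      + 4 / 3 * (x (.PP 2) * y (.GG 2) + x (.GG 2) * y (.PP 2))
      + (x (.PP 1) * y (.GG 1) + x (.GG 1) * y (.PP 1))
      - 2 / 3 * (x (.PP 0) * y (.GG 2) + x (.GG 2) * y (.PP 0))
      - 2 / 3 * (x (.PP 2) * y (.GG 0) + x (.GG 0) * y (.PP 2)) := by
  simp [B, M, mq, kd, fidx, sum_idx, Fin.sum_univ_two, Fin.sum_univ_three]
  ring

theorem br_skew (x y : V) : br x y = -br y x := by
  funext i
  revert i
  simp only [forall_idx, Fin.forall_fin_succ, Pi.neg_apply]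
  simp only [IsEmpty.forall_iff, and_true, Fin.succ_zero_eq_one, Fin.succ_one_eq_two,
    br_apply_J, br_apply_H, br_apply_G_0, br_apply_G_1, br_apply_P_0,
    br_apply_P_1, br_apply_JJ_0, br_apply_JJ_1, br_apply_HH_0, br_apply_HH_1,
    br_apply_GG_0, br_apply_GG_1, br_apply_GG_2, br_apply_PP_0, br_apply_PP_1,
    br_apply_PP_2]
  refine ⟨?_, ?_, ⟨?_, ?_⟩, ⟨?_, ?_⟩, ⟨?_, ?_⟩, ⟨?_, ?_⟩, ⟨?_, ?_, ?_⟩, ?_, ?_, ?_⟩ <;> ring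

theorem jacobi (x y z : V) : br x (br y z) + br z (br x y) + br y (br z x) = 0 := by
  funext i
  revert i
  simp only [forall_idx, Fin.forall_fin_succ, Pi.add_apply, Pi.zero_apply]
  simp only [IsEmpty.forall_iff, and_true, Fin.succ_zero_eq_one, Fin.succ_one_eq_two,
    br_apply_J, br_apply_H, br_apply_G_0, br_apply_G_1, br_apply_P_0,
    br_apply_P_1, br_apply_JJ_0, br_apply_JJ_1, br_apply_HH_0, br_apply_HH_1,
    br_apply_GG_0, br_apply_GG_1, br_apply_GG_2, br_apply_PP_0, br_apply_PP_1,
    br_apply_PP_2]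
  refine ⟨?_, ?_, ⟨?_, ?_⟩, ⟨?_, ?_⟩, ⟨?_, ?_⟩, ⟨?_, ?_⟩, ⟨?_, ?_, ?_⟩, ?_, ?_, ?_⟩ <;> ring

theorem B_symm (x y : V) : B x y = B y x := by
  simp only [B_eq]
  ring

theorem B_invariant (z x y : V) : B (br z x) y + B x (br z y) = 0 := by
  simp only [B_eq, br_apply_J, br_apply_H, br_apply_G_0, br_apply_G_1, br_apply_P_0,
    br_apply_P_1, br_apply_JJ_0, br_apply_JJ_1, br_apply_HH_0, br_apply_HH_1,
    br_apply_GG_0, br_apply_GG_1, br_apply_GG_2, br_apply_PP_0, br_apply_PP_1,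
    br_apply_PP_2]
  ring

theorem B_nondegenerate (x : V) (h : ∀ y : V, B x y = 0) : x = 0 := by
  have he (i : Idx) : B x (e i) = 0 := h (e i)
  simp only [forall_idx, Fin.forall_fin_succ, B_eq] at he
  simp [e] at he
  funext i
  revert i
  simp only [forall_idx, Fin.forall_fin_succ, Pi.zero_apply]
  simp only [IsEmpty.forall_iff, and_true, Fin.succ_zero_eq_one, Fin.succ_one_eq_two]
  refine ⟨?_, ?_, ⟨?_, ?_⟩, ⟨?_, ?_⟩, ⟨?_, ?_⟩, ⟨?_, ?_⟩, ⟨?_, ?_, ?_⟩, ?_, ?_, ?_⟩ <;> linarith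

/-- `hs₃car1` is a Lie algebra (the listed brackets are
skew-symmetric and satisfy the Jacobi identity), and the stated bilinear form is
an invariant metric on it (symmetric, invariant, nondegenerate). -/
theorem hs3car1_lie_algebra_and_invariant_metric :
    (∀ x y : V, br x y = -br y x) ∧
    (∀ x y z : V, br x (br y z) + br z (br x y) + br y (br z x) = 0) ∧
    (∀ x y : V, B x y = B y x) ∧
    (∀ z x y : V, B (br z x) y + B x (br z y) = 0) ∧
    (∀ x : V, (∀ y : V, B x y = 0) → x = 0) := by
  exact ⟨br_skew, jacobi, B_symm, B_invariant, B_nondegenerate⟩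

end HS3Car1
end

section
/- Neither of the two spin-3 Galilei algebras admits an invariant metric. Concretely: (i) the 16-dimensional real Lie algebra hs₃gal1 with basis {J, H, G_a, P_a, J_a, H_a, G_{ab} = G_{ba}, P_{ab} = P_{ba}} and nonvanishing brackets [J,G_a] = ε_{am}G_m; [J,P_a] = ε_{am}P_m; [G_a,H] = −ε_{am}P_m; [J,J_a] = ε_{am}J_m; [J,G_{ab}] = −ε_{m(a}G_{b)m}; [J,H_a] = ε_{am}H_m; [J,P_{ab}] = −ε_{m(a}P_{b)m}; [G_a,J_b] = −(ε_{am}G_{bm} + ε_{ab}G_{mm}); [G_a,H_b] = −(ε_{am}P_{bm} + ε_{ab}P_{mm}); [H,J_a] = ε_{am}H_m; [H,G_{ab}] = −ε_{m(a}P_{b)m}; [P_a,J_b] = −(ε_{am}P_{bm} + ε_{ab}P_{mm}); [J_a,J_b] = ε_{ab}J; [J_a,G_{bc}] = δ_{a(b}ε_{c)m}G_m; [J_a,H_b] = ε_{ab}H; [J_a,P_{bc}] = δ_{a(b}ε_{c)m}P_m; [G_{ab},H_c] = −δ_{c(a}ε_{b)m}P_m, and (ii) the 16-dimensional real Lie algebra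 hs₃gal2 with the same basis and nonvanishing brackets [J,G_a] = ε_{am}G_m; [J,P_a] = ε_{am}P_m; [G_a,H] = −ε_{am}P_m; [J,J_a] = ε_{am}J_m; [J,G_{ab}] = −ε_{m(a}G_{b)m}; [J,H_a] = ε_{am}H_m; [J,P_{ab}] = −ε_{m(a}P_{b)m}; [G_a,G_{bc}] = −ε_{a(b}J_{c)}; [G_a,P_{bc}] = −ε_{a(b}H_{c)}; [H,J_a] = ε_{am}H_m; [H,G_{ab}] = −ε_{m(a}P_{b)m}; [P_a,G_{bc}] = −ε_{a(b}H_{c)}; [J_a,G_{bc}] = δ_{a(b}ε_{c)m}G_m; [J_a,P_{bc}] = δ_{a(b}ε_{c)m}P_m; [G_{ab},G_{cd}] = δ_{(a(c}ε_{d)b)}J; [G_{ab},H_c] = −δ_{c(a}ε_{b)m}P_m; [G_{ab},P_{cd}] = δ_{(a(c}ε_{d)b)}H each have the property that every symmetric invariant bilinear form on them is degenerate. -/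
namespace HS3Gal

/-- Basis index type for the spin-3 Galilei algebras `hs₃gal1`, `hs₃gal2`:
`J, H, G_a, P_a, J_a, H_a` and the symmetric pairs `G_{ab}`, `P_{ab}` (encoded by
`Fin 3` via `0 ↦ (1,1)`, `1 ↦ (1,2)`, `2 ↦ (2,2)`). -/
inductive Idx : Type
  | J : Idx
  | H : Idx
  | G : Fin 2 → Idx
  | P : Fin 2 → Idx
  | JJ : Fin 2 → Idx
  | HH : Fin 2 → Idx
  | GG : Fin 3 → Idx
  | PP : Fin 3 → Idx
  deriving DecidableEq, Fintype

def eps (a b : Fin 2) : ℝ := if a = b then 0 else if a = 0 then 1 else -1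
def kd (a b : Fin 2) : ℝ := if a = b then 1 else 0

def sidx (a b : Fin 2) : Fin 3 :=
  if a = 0 then (if b = 0 then 0 else 1) else (if b = 0 then 1 else 2)
def fidx : Fin 3 → Fin 2 × Fin 2 := ![(0, 0), (0, 1), (1, 1)]

abbrev V : Type := Idx → ℝ
def e (i : Idx) : V := fun j => if j = i then 1 else 0

def vJ : V := e .J
def vH : V := e .H
def vG (a : Fin 2) : V := e (.G a)
def vP (a : Fin 2) : V := e (.P a)
def vJJ (a : Fin 2) : V := e (.JJ a)
def vHH (a : Fin 2) : V := e (.HH a)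
def vGG (a b : Fin 2) : V := e (.GG (sidx a b))
def vPP (a b : Fin 2) : V := e (.PP (sidx a b))

noncomputable def cJG (a : Fin 2) : V := ∑ m, eps a m • vG m
noncomputable def cJP (a : Fin 2) : V := ∑ m, eps a m • vP m
noncomputable def cJJJ (a : Fin 2) : V := ∑ m, eps a m • vJJ m
noncomputable def cJHH (a : Fin 2) : V := ∑ m, eps a m • vHH m
/-- `−ε_{m(a} G_{b)m}`. -/
noncomputable def cJGG (a b : Fin 2) : V :=
  -((∑ m, eps m a • vGG b m) + (∑ m, eps m b • vGG a m))
/-- `−ε_{m(a} P_{b)m}`. -/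
noncomputable def cJPP (a b : Fin 2) : V :=
  -((∑ m, eps m a • vPP b m) + (∑ m, eps m b • vPP a m))
/-- `−(ε_{am} G_{bm} + ε_{ab} G_{mm})`. -/
noncomputable def cGJJ (a b : Fin 2) : V :=
  -((∑ m, eps a m • vGG b m) + eps a b • (∑ m, vGG m m))
/-- `−(ε_{am} P_{bm} + ε_{ab} P_{mm})`. -/
noncomputable def cPJJ (a b : Fin 2) : V :=
  -((∑ m, eps a m • vPP b m) + eps a b • (∑ m, vPP m m))
/-- `−ε_{a(b} J_{c)}`. -/
noncomputable def cGGGs (a b c : Fin 2) : V := -(eps a b • vJJ c + eps a c • vJJ b)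
/-- `−ε_{a(b} H_{c)}`. -/
noncomputable def cGPP (a b c : Fin 2) : V := -(eps a b • vHH c + eps a c • vHH b)
/-- `δ_{a(b} ε_{c)m} G_m`. -/
noncomputable def cJJGG (a b c : Fin 2) : V :=
  ∑ m, (kd a b * eps c m + kd a c * eps b m) • vG m
/-- `δ_{a(b} ε_{c)m} P_m`. -/
noncomputable def cJJPP (a b c : Fin 2) : V :=
  ∑ m, (kd a b * eps c m + kd a c * eps b m) • vP m
/-- `[G_{ab}, H_c] = −δ_{c(a} ε_{b)m} P_m`. -/
noncomputable def cGGHH (a b c : Fin 2) : V :=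
  -(∑ m, (kd c a * eps b m + kd c b * eps a m) • vP m)
/-- `δ_{(a(c} ε_{d)b)}`. -/
def symDE (a b c d : Fin 2) : ℝ :=
  kd a c * eps d b + kd a d * eps c b + kd b c * eps d a + kd b d * eps c a

/-- Structure constants of `hs₃gal1`. -/
noncomputable def c1 : Idx → Idx → V
  | .J, .G a => cJG a
  | .G a, .J => -cJG a
  | .J, .P a => cJP a
  | .P a, .J => -cJP a
  | .G a, .H => -cJP a
  | .H, .G a => cJP a
  | .J, .JJ a => cJJJ a
  | .JJ a, .J => -cJJJ a
  | .J, .GG s => cJGG (fidx s).1 (fidx s).2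
  | .GG s, .J => -cJGG (fidx s).1 (fidx s).2
  | .J, .HH a => cJHH a
  | .HH a, .J => -cJHH a
  | .J, .PP s => cJPP (fidx s).1 (fidx s).2
  | .PP s, .J => -cJPP (fidx s).1 (fidx s).2
  | .G a, .JJ b => cGJJ a b
  | .JJ b, .G a => -cGJJ a b
  | .G a, .HH b => cPJJ a b
  | .HH b, .G a => -cPJJ a b
  | .H, .JJ a => cJHH a
  | .JJ a, .H => -cJHH a
  | .H, .GG s => cJPP (fidx s).1 (fidx s).2
  | .GG s, .H => -cJPP (fidx s).1 (fidx s).2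
  | .P a, .JJ b => cPJJ a b
  | .JJ b, .P a => -cPJJ a b
  | .JJ a, .JJ b => eps a b • vJ
  | .JJ a, .GG s => cJJGG a (fidx s).1 (fidx s).2
  | .GG s, .JJ a => -cJJGG a (fidx s).1 (fidx s).2
  | .JJ a, .HH b => eps a b • vH
  | .HH a, .JJ b => eps a b • vH
  | .JJ a, .PP s => cJJPP a (fidx s).1 (fidx s).2
  | .PP s, .JJ a => -cJJPP a (fidx s).1 (fidx s).2
  | .GG s, .HH d => cGGHH (fidx s).1 (fidx s).2 d
  | .HH d, .GG s => -cGGHH (fidx s).1 (fidx s).2 d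
  | _, _ => 0

/-- Structure constants of `hs₃gal2`. -/
noncomputable def c2 : Idx → Idx → V
  | .J, .G a => cJG a
  | .G a, .J => -cJG a
  | .J, .P a => cJP a
  | .P a, .J => -cJP a
  | .G a, .H => -cJP a
  | .H, .G a => cJP a
  | .J, .JJ a => cJJJ a
  | .JJ a, .J => -cJJJ a
  | .J, .GG s => cJGG (fidx s).1 (fidx s).2
  | .GG s, .J => -cJGG (fidx s).1 (fidx s).2
  | .J, .HH a => cJHH a
  | .HH a, .J => -cJHH a
  | .J, .PP s => cJPP (fidx s).1 (fidx s).2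
  | .PP s, .J => -cJPP (fidx s).1 (fidx s).2
  | .G a, .GG s => cGGGs a (fidx s).1 (fidx s).2
  | .GG s, .G a => -cGGGs a (fidx s).1 (fidx s).2
  | .G a, .PP s => cGPP a (fidx s).1 (fidx s).2
  | .PP s, .G a => -cGPP a (fidx s).1 (fidx s).2
  | .H, .JJ a => cJHH a
  | .JJ a, .H => -cJHH a
  | .H, .GG s => cJPP (fidx s).1 (fidx s).2
  | .GG s, .H => -cJPP (fidx s).1 (fidx s).2
  | .P a, .GG s => cGPP a (fidx s).1 (fidx s).2
  | .GG s, .P a => -cGPP a (fidx s).1 (fidx s).2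
  | .JJ a, .GG s => cJJGG a (fidx s).1 (fidx s).2
  | .GG s, .JJ a => -cJJGG a (fidx s).1 (fidx s).2
  | .JJ a, .PP s => cJJPP a (fidx s).1 (fidx s).2
  | .PP s, .JJ a => -cJJPP a (fidx s).1 (fidx s).2
  | .GG s, .GG t => symDE (fidx s).1 (fidx s).2 (fidx t).1 (fidx t).2 • vJ
  | .GG s, .HH d => cGGHH (fidx s).1 (fidx s).2 d
  | .HH d, .GG s => -cGGHH (fidx s).1 (fidx s).2 d
  | .GG s, .PP t => symDE (fidx s).1 (fidx s).2 (fidx t).1 (fidx t).2 • vH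
  | .PP t, .GG s => -(symDE (fidx s).1 (fidx s).2 (fidx t).1 (fidx t).2) • vH
  | _, _ => 0

/-- Bilinear brackets extending the structure constants. -/
noncomputable def br1 (x y : V) : V := ∑ i, ∑ j, (x i * y j) • c1 i j
noncomputable def br2 (x y : V) : V := ∑ i, ∑ j, (x i * y j) • c2 i j

/-- The `(i, j)` Plücker coordinate of the bivector `x ∧ y`. -/
def wedge (x y : V) (i j : Idx) : ℝ := x i * y j - x j * y i

lemma sum_idx {M : Type*} [AddCommMonoid M] (f : Idx → M) :
    ∑ i, f i = f .J + f .H + ∑ a, f (.G a) + ∑ a, f (.P a) + ∑ a, f (.JJ a) + ∑ a, f (.HH a) +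
      ∑ s, f (.GG s) + ∑ s, f (.PP s) := by
  have h : (Finset.univ : Finset Idx) = {.J, .H, .G 0, .G 1, .P 0, .P 1, .JJ 0, .JJ 1,
      .HH 0, .HH 1, .GG 0, .GG 1, .GG 2, .PP 0, .PP 1, .PP 2} := by decide
  rw [h]
  simp [Fin.sum_univ_succ, add_assoc]

/-- The bracket of `hs₃gal1` in coordinates. -/
def coordBr1 (x y : V) : V
  | .J =>
      wedge x y (.JJ 0) (.JJ 1)
  | .H =>
      wedge x y (.JJ 0) (.HH 1) - wedge x y (.JJ 1) (.HH 0)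
  | .G 0 =>
      -wedge x y .J (.G 1) - wedge x y (.JJ 0) (.GG 1) - 2 * wedge x y (.JJ 1) (.GG 2)
  | .G 1 =>
      wedge x y .J (.G 0) + 2 * wedge x y (.JJ 0) (.GG 0) + wedge x y (.JJ 1) (.GG 1)
  | .P 0 =>
      -wedge x y .J (.P 1) - wedge x y .H (.G 1) - wedge x y (.JJ 0) (.PP 1)
      - 2 * wedge x y (.JJ 1) (.PP 2) - wedge x y (.HH 0) (.GG 1) - 2 * wedge x y (.HH 1) (.GG 2)
  | .P 1 =>
      wedge x y .J (.P 0) + wedge x y .H (.G 0) + 2 * wedge x y (.JJ 0) (.PP 0)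
      + wedge x y (.JJ 1) (.PP 1) + 2 * wedge x y (.HH 0) (.GG 0) + wedge x y (.HH 1) (.GG 1)
  | .JJ 0 =>
      -wedge x y .J (.JJ 1)
  | .JJ 1 =>
      wedge x y .J (.JJ 0)
  | .HH 0 =>
      -wedge x y .J (.HH 1) - wedge x y .H (.JJ 1)
  | .HH 1 =>
      wedge x y .J (.HH 0) + wedge x y .H (.JJ 0)
  | .GG 0 =>
      -wedge x y .J (.GG 1) - wedge x y (.G 0) (.JJ 1) + 2 * wedge x y (.G 1) (.JJ 0)
  | .GG 1 =>
      2 * wedge x y .J (.GG 0) - 2 * wedge x y .J (.GG 2) - wedge x y (.G 0) (.JJ 0)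
      + wedge x y (.G 1) (.JJ 1)
  | .GG 2 =>
      wedge x y .J (.GG 1) - 2 * wedge x y (.G 0) (.JJ 1) + wedge x y (.G 1) (.JJ 0)
  | .PP 0 =>
      -wedge x y .J (.PP 1) - wedge x y .H (.GG 1) - wedge x y (.G 0) (.HH 1)
      + 2 * wedge x y (.G 1) (.HH 0) - wedge x y (.P 0) (.JJ 1) + 2 * wedge x y (.P 1) (.JJ 0)
  | .PP 1 =>
      2 * wedge x y .J (.PP 0) - 2 * wedge x y .J (.PP 2) + 2 * wedge x y .H (.GG 0)
      - 2 * wedge x y .H (.GG 2) - wedge x y (.G 0) (.HH 0) + wedge x y (.G 1) (.HH 1)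
      - wedge x y (.P 0) (.JJ 0) + wedge x y (.P 1) (.JJ 1)
  | .PP 2 =>
      wedge x y .J (.PP 1) + wedge x y .H (.GG 1) - 2 * wedge x y (.G 0) (.HH 1)
      + wedge x y (.G 1) (.HH 0) - 2 * wedge x y (.P 0) (.JJ 1) + wedge x y (.P 1) (.JJ 0)

set_option maxHeartbeats 1000000 in
lemma br1_eq_coordBr (x y : V) : br1 x y = coordBr1 x y := by
  funext i
  simp only [br1, sum_idx, Fin.sum_univ_two, Fin.sum_univ_three, c1]
  rcases i with _ | _ | a | a | a | a | s | s
  all_goals first | fin_cases a | fin_cases s | skip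
  all_goals
    simp [cJG, cJP, cJJJ, cJHH, cJGG, cJPP, cGJJ, cPJJ, cJJGG, cJJPP, cGGHH,
      eps, kd, fidx, sidx, vJ, vH, vG, vP, vJJ, vHH, vGG, vPP, e, coordBr1, wedge]
    try ring

lemma coordBr1_anticomm (x y : V) : coordBr1 x y = -coordBr1 y x := by
  funext i
  rcases i with _ | _ | a | a | a | a | s | s
  all_goals first | fin_cases a | fin_cases s | skip
  all_goals
    simp only [Pi.neg_apply, coordBr1, wedge]
    ring

lemma jacobi1 (x y z : V) : br1 x (br1 y z) + br1 z (br1 x y) + br1 y (br1 z x) = 0 := by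
  simp only [br1_eq_coordBr]
  funext i
  rcases i with _ | _ | a | a | a | a | s | s
  all_goals first | fin_cases a | fin_cases s | skip
  all_goals
    simp only [Pi.add_apply, Pi.zero_apply, coordBr1, wedge]
    ring

/-- The bracket of `hs₃gal2` in coordinates. -/
def coordBr2 (x y : V) : V
  | .J =>
      -2 * wedge x y (.GG 0) (.GG 1) - 2 * wedge x y (.GG 1) (.GG 2)
  | .H =>
      -2 * wedge x y (.GG 0) (.PP 1) + 2 * wedge x y (.GG 1) (.PP 0)
      - 2 * wedge x y (.GG 1) (.PP 2) + 2 * wedge x y (.GG 2) (.PP 1)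
  | .G 0 =>
      -wedge x y .J (.G 1) - wedge x y (.JJ 0) (.GG 1) - 2 * wedge x y (.JJ 1) (.GG 2)
  | .G 1 =>
      wedge x y .J (.G 0) + 2 * wedge x y (.JJ 0) (.GG 0) + wedge x y (.JJ 1) (.GG 1)
  | .P 0 =>
      -wedge x y .J (.P 1) - wedge x y .H (.G 1) - wedge x y (.JJ 0) (.PP 1)
      - 2 * wedge x y (.JJ 1) (.PP 2) - wedge x y (.HH 0) (.GG 1) - 2 * wedge x y (.HH 1) (.GG 2)
  | .P 1 =>
      wedge x y .J (.P 0) + wedge x y .H (.G 0) + 2 * wedge x y (.JJ 0) (.PP 0)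
      + wedge x y (.JJ 1) (.PP 1) + 2 * wedge x y (.HH 0) (.GG 0) + wedge x y (.HH 1) (.GG 1)
  | .JJ 0 =>
      -wedge x y .J (.JJ 1) - wedge x y (.G 0) (.GG 1) + 2 * wedge x y (.G 1) (.GG 0)
  | .JJ 1 =>
      wedge x y .J (.JJ 0) - 2 * wedge x y (.G 0) (.GG 2) + wedge x y (.G 1) (.GG 1)
  | .HH 0 =>
      -wedge x y .J (.HH 1) - wedge x y .H (.JJ 1) - wedge x y (.G 0) (.PP 1)
      + 2 * wedge x y (.G 1) (.PP 0) - wedge x y (.P 0) (.GG 1) + 2 * wedge x y (.P 1) (.GG 0)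
  | .HH 1 =>
      wedge x y .J (.HH 0) + wedge x y .H (.JJ 0) - 2 * wedge x y (.G 0) (.PP 2)
      + wedge x y (.G 1) (.PP 1) - 2 * wedge x y (.P 0) (.GG 2) + wedge x y (.P 1) (.GG 1)
  | .GG 0 =>
      -wedge x y .J (.GG 1)
  | .GG 1 =>
      2 * wedge x y .J (.GG 0) - 2 * wedge x y .J (.GG 2)
  | .GG 2 =>
      wedge x y .J (.GG 1)
  | .PP 0 =>
      -wedge x y .J (.PP 1) - wedge x y .H (.GG 1)
  | .PP 1 =>
      2 * wedge x y .J (.PP 0) - 2 * wedge x y .J (.PP 2) + 2 * wedge x y .H (.GG 0)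
      - 2 * wedge x y .H (.GG 2)
  | .PP 2 =>
      wedge x y .J (.PP 1) + wedge x y .H (.GG 1)

set_option maxHeartbeats 1000000 in
lemma br2_eq_coordBr (x y : V) : br2 x y = coordBr2 x y := by
  funext i
  simp only [br2, sum_idx, Fin.sum_univ_two, Fin.sum_univ_three, c2]
  rcases i with _ | _ | a | a | a | a | s | s
  all_goals first | fin_cases a | fin_cases s | skip
  all_goals
    simp [cJG, cJP, cJJJ, cJHH, cJGG, cJPP, cGGGs, cGPP, cJJGG, cJJPP, cGGHH, symDE,
      eps, kd, fidx, sidx, vJ, vH, vG, vP, vJJ, vHH, vGG, vPP, e, coordBr2, wedge]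
    try ring

lemma coordBr2_anticomm (x y : V) : coordBr2 x y = -coordBr2 y x := by
  funext i
  rcases i with _ | _ | a | a | a | a | s | s
  all_goals first | fin_cases a | fin_cases s | skip
  all_goals
    simp only [Pi.neg_apply, coordBr2, wedge]
    ring

lemma jacobi2 (x y z : V) : br2 x (br2 y z) + br2 z (br2 x y) + br2 y (br2 z x) = 0 := by
  simp only [br2_eq_coordBr]
  funext i
  rcases i with _ | _ | a | a | a | a | s | s
  all_goals first | fin_cases a | fin_cases s | skip
  all_goals
    simp only [Pi.add_apply, Pi.zero_apply, coordBr2, wedge]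
    ring

lemma e_eq_single (i : Idx) : e i = Pi.single i 1 := by
  funext j
  simp [e, Pi.single_apply]

lemma eq_zero_of_basis (f : V →ₗ[ℝ] ℝ) (h : ∀ i, f (e i) = 0) : f = 0 :=
  (Pi.basisFun ℝ Idx).ext fun i => by simpa [e_eq_single] using h i

lemma e_ne_zero (i : Idx) : e i ≠ 0 := fun h => by simpa [e] using congrFun h i

lemma br1_e (i j : Idx) : br1 (e i) (e j) = c1 i j := by
  simp [br1, e]

/-- `P_1` lies in the radical of every symmetric invariant form on `hs₃gal1`. -/
lemma apply_P_eq_zero_of_invariant1 (B : V →ₗ[ℝ] V →ₗ[ℝ] ℝ) (hs : ∀ x y : V, B x y = B y x)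
    (hB : ∀ z x y : V, B (br1 z x) y + B x (br1 z y) = 0) (y : V) : B (e (.P 0)) y = 0 := by
  refine LinearMap.congr_fun (eq_zero_of_basis (B (e (.P 0))) fun i => ?_) y
  have hc (i j l : Idx) : B (c1 i j) (e l) + B (e j) (c1 i l) = 0 := by
    simpa only [br1_e] using hB (e i) (e j) (e l)
  obtain ⟨u, v, w, h⟩ : ∃ u v w : Idx,
      B (c1 u v) (e w) + B (e v) (c1 u w) = 0 → B (e (.P 0)) (e i) = 0 := by
    have hs' (j : Idx) : B (e j) (e (.P 0)) = B (e (.P 0)) (e j) := hs _ _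
    refine match i with
    | .J => ⟨.H, .J, .G 1, ?_⟩
    | .H => ⟨.J, .H, .P 1, ?_⟩
    | .G 0 => ⟨.G 1, .H, .G 0, ?_⟩
    | .G 1 => ⟨.G 1, .H, .G 1, ?_⟩
    | .P 0 => ⟨.PP 1, .P 0, .JJ 0, ?_⟩
    | .P 1 => ⟨.PP 1, .P 0, .JJ 1, ?_⟩
    | .JJ 0 => ⟨.PP 1, .JJ 0, .JJ 0, ?_⟩
    | .JJ 1 => ⟨.HH 1, .JJ 1, .GG 2, ?_⟩
    | .HH 0 => ⟨.H, .P 0, .JJ 1, ?_⟩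
    | .HH 1 => ⟨.HH 0, .J, .P 0, ?_⟩
    | .GG 0 => ⟨.JJ 1, .GG 0, .PP 2, ?_⟩
    | .GG 1 => ⟨.PP 1, .JJ 0, .GG 1, ?_⟩
    | .GG 2 => ⟨.PP 1, .JJ 0, .GG 2, ?_⟩
    | .PP 0 => ⟨.PP 1, .JJ 0, .PP 0, ?_⟩
    | .PP 1 => ⟨.PP 2, .JJ 1, .PP 1, ?_⟩
    | .PP 2 => ⟨.P 1, .J, .PP 2, ?_⟩
    all_goals
      simp [c1, cJP, cJHH, cJJGG, cJJPP, cGGHH, eps, kd, fidx, vH, vG, vP, vHH, hs', ← two_mul]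
  exact h (hc u v w)

lemma br2_e (i j : Idx) : br2 (e i) (e j) = c2 i j := by
  simp [br2, e]

/-- `P_1` lies in the radical of every symmetric invariant form on `hs₃gal2`. -/
lemma apply_P_eq_zero_of_invariant2 (B : V →ₗ[ℝ] V →ₗ[ℝ] ℝ) (hs : ∀ x y : V, B x y = B y x)
    (hB : ∀ z x y : V, B (br2 z x) y + B x (br2 z y) = 0) (y : V) : B (e (.P 0)) y = 0 := by
  refine LinearMap.congr_fun (eq_zero_of_basis (B (e (.P 0))) fun i => ?_) y
  have hc (i j l : Idx) : B (c2 i j) (e l) + B (e j) (c2 i l) = 0 := by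
    simpa only [br2_e] using hB (e i) (e j) (e l)
  obtain ⟨u, v, w, h⟩ : ∃ u v w : Idx,
      B (c2 u v) (e w) + B (e v) (c2 u w) = 0 → B (e (.P 0)) (e i) = 0 := by
    have hs' (j : Idx) : B (e j) (e (.P 0)) = B (e (.P 0)) (e j) := hs _ _
    refine match i with
    | .J => ⟨.J, .J, .P 1, ?_⟩
    | .H => ⟨.H, .H, .G 1, ?_⟩
    | .G 0 => ⟨.JJ 0, .G 0, .PP 1, ?_⟩
    | .G 1 => ⟨.G 0, .J, .P 0, ?_⟩
    | .P 0 => ⟨.HH 0, .P 0, .GG 1, ?_⟩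
    | .P 1 => ⟨.J, .P 1, .P 1, ?_⟩
    | .JJ 0 => ⟨.G 0, .P 0, .GG 1, ?_⟩
    | .JJ 1 => ⟨.G 1, .H, .JJ 1, ?_⟩
    | .HH 0 => ⟨.P 1, .J, .HH 0, ?_⟩
    | .HH 1 => ⟨.JJ 0, .HH 1, .PP 1, ?_⟩
    | .GG 0 => ⟨.PP 2, .JJ 1, .GG 0, ?_⟩
    | .GG 1 => ⟨.HH 0, .GG 1, .GG 1, ?_⟩
    | .GG 2 => ⟨.P 1, .J, .GG 2, ?_⟩
    | .PP 0 => ⟨.HH 0, .GG 1, .PP 0, ?_⟩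
    | .PP 1 => ⟨.HH 0, .GG 1, .PP 1, ?_⟩
    | .PP 2 => ⟨.JJ 0, .PP 1, .PP 2, ?_⟩
    all_goals
      simp [c2, cJG, cJP, cGGGs, cGPP, cJJPP, cGGHH, symDE, eps, kd, fidx, vH, vG, vP, vJJ, vHH,
        hs', ← two_mul]
  exact h (hc u v w)

/-- both spin-3 Galilei algebras `hs₃gal1` and `hs₃gal2` are Lie
algebras, and neither admits an invariant metric: every symmetric invariant
bilinear form on each of them is degenerate. -/
theorem spin3_galilei_no_invariant_metric :
    ((∀ x y : V, br1 x y = -br1 y x) ∧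
     (∀ x y z : V, br1 x (br1 y z) + br1 z (br1 x y) + br1 y (br1 z x) = 0) ∧
     (∀ B : V →ₗ[ℝ] V →ₗ[ℝ] ℝ,
       (∀ x y : V, B x y = B y x) →
       (∀ z x y : V, B (br1 z x) y + B x (br1 z y) = 0) →
       ∃ x : V, x ≠ 0 ∧ ∀ y : V, B x y = 0)) ∧
    ((∀ x y : V, br2 x y = -br2 y x) ∧
     (∀ x y z : V, br2 x (br2 y z) + br2 z (br2 x y) + br2 y (br2 z x) = 0) ∧
     (∀ B : V →ₗ[ℝ] V →ₗ[ℝ] ℝ,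
       (∀ x y : V, B x y = B y x) →
       (∀ z x y : V, B (br2 z x) y + B x (br2 z y) = 0) →
       ∃ x : V, x ≠ 0 ∧ ∀ y : V, B x y = 0)) := by
  exact
    ⟨⟨fun x y => by simpa only [br1_eq_coordBr] using coordBr1_anticomm x y, jacobi1, fun B hs hB =>
        ⟨e (.P 0), e_ne_zero _, apply_P_eq_zero_of_invariant1 B hs hB⟩⟩,
      fun x y => by simpa only [br2_eq_coordBr] using coordBr2_anticomm x y, jacobi2, fun B hs hB =>
        ⟨e (.P 0), e_ne_zero _, apply_P_eq_zero_of_invariant2 B hs hB⟩⟩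

end HS3Gal
end

section
/- The spin-3 Extended Bargmann algebra hs₃ebarg1 — the 24-dimensional real vector space with basis {J, H, G_a, P_a, J_a, H_a, G_{ab} = G_{ba}, P_{ab} = P_{ba}, J*, H*, J*_a, H*_a : a,b ∈ {1,2}} and nonvanishing brackets [J,G_a] = ε_{am}G_m; [J,P_a] = ε_{am}P_m; [G_a,H] = −ε_{am}P_m; [G_a,G_b] = ε_{ab}H*; [P_a,G_b] = ε_{ab}J*; [J,J_a] = ε_{am}J_m; [J,G_{ab}] = −ε_{m(a}G_{b)m}; [J,H_a] = ε_{am}H_m; [J,P_{ab}] = −ε_{m(a}P_{b)m}; [G_a,J_b] = −(ε_{am}G_{bm} + ε_{ab}G_{mm}); [G_a,H_b] = −(ε_{am}P_{bm} + ε_{ab}P_{mm}); [H,J_a] = ε_{am}H_m; [H,G_{ab}] = −ε_{m(a}P_{b)m}; [P_a,J_b] = −(ε_{am}P_{bm} + ε_{ab}P_{mm}); [J_a,J_b] = ε_{ab}J; [J_a,G_{bc}] = δ_{a(b}ε_{c)m}G_m; [J_a,H_b] = ε_{ab}H; [J_a,P_{bc}] = δ_{a(b}ε_{c)m}P_m;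 [G_{ab},H_c] = −δ_{c(a}ε_{b)m}P_m; [G_{ab},G_{cd}] = ε_{(a(c}δ_{d)b)}H*; [P_{ab},G_{cd}] = ε_{(a(c}δ_{d)b)}J*; [P_a,G_{bc}] = ε_{a(b}J*_{c)}; [G_a,G_{bc}] = ε_{a(b}H*_{c)}; [G_a,P_{bc}] = ε_{a(b}J*_{c)}; [J,H*_a] = ε_{am}H*_m; [J,J*_a] = ε_{am}J*_m; [H,H*_a] = ε_{am}J*_m; [J_a,J*] = −ε_{am}J*_m; [J_a,H*] = −ε_{am}H*_m; [J_a,J*_b] = ε_{ab}J*; [J_a,H*_b] = ε_{ab}H*; [H_a,H*] = −ε_{am}J*_m; [H_a,H*_b] = ε_{ab}J* — is a Lie algebra (the brackets satisfy the Jacobi identity), and the symmetric bilinear form with nonvanishing entries ⟨P_a,G_b⟩ = δ_{ab}, ⟨P_{ab},G_{cd}⟩ = δ_{a(c}δ_{d)b} − (2/3)δ_{ab}δ_{cd}, ⟨H,H*⟩ = 1, ⟨J,J*⟩ = 1, ⟨H_a,H*_b⟩ = δ_{ab}, ⟨J_a,J*_b⟩ = δ_{ab} is an invariant metric on hs₃ebarg1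 (symmetric, invariant, nondegenerate). -/
namespace HS3EBarg1

/-- Basis index type for the spin-3 Extended Bargmann algebra `hs₃ebarg1`:
`J, H, G_a, P_a, J_a, H_a`, the symmetric pairs `G_{ab}`, `P_{ab}` (encoded by
`Fin 3` via `0 ↦ (1,1)`, `1 ↦ (1,2)`, `2 ↦ (2,2)`), and the extensions
`J*, H*, J*_a, H*_a`. -/
inductive Idx : Type
  | J : Idx
  | H : Idx
  | G : Fin 2 → Idx
  | P : Fin 2 → Idx
  | JJ : Fin 2 → Idx
  | HH : Fin 2 → Idx
  | GG : Fin 3 → Idx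
  | PP : Fin 3 → Idx
  | Js : Idx
  | Hs : Idx
  | JJs : Fin 2 → Idx
  | HHs : Fin 2 → Idx
  deriving DecidableEq, Fintype

def eps (a b : Fin 2) : ℝ := if a = b then 0 else if a = 0 then 1 else -1
def kd (a b : Fin 2) : ℝ := if a = b then 1 else 0

def sidx (a b : Fin 2) : Fin 3 :=
  if a = 0 then (if b = 0 then 0 else 1) else (if b = 0 then 1 else 2)
def fidx : Fin 3 → Fin 2 × Fin 2 := ![(0, 0), (0, 1), (1, 1)]

abbrev V : Type := Idx → ℝ
def e (i : Idx) : V := fun j => if j = i then 1 else 0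

def vJ : V := e .J
def vH : V := e .H
def vG (a : Fin 2) : V := e (.G a)
def vP (a : Fin 2) : V := e (.P a)
def vJJ (a : Fin 2) : V := e (.JJ a)
def vHH (a : Fin 2) : V := e (.HH a)
def vGG (a b : Fin 2) : V := e (.GG (sidx a b))
def vPP (a b : Fin 2) : V := e (.PP (sidx a b))
def vJs : V := e .Js
def vHs : V := e .Hs
def vJJs (a : Fin 2) : V := e (.JJs a)
def vHHs (a : Fin 2) : V := e (.HHs a)

noncomputable def cJG (a : Fin 2) : V := ∑ m, eps a m • vG m
noncomputable def cJP (a : Fin 2) : V := ∑ m, eps a m • vP m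
noncomputable def cJJJ (a : Fin 2) : V := ∑ m, eps a m • vJJ m
noncomputable def cJHH (a : Fin 2) : V := ∑ m, eps a m • vHH m
/-- `−ε_{m(a} G_{b)m}`. -/
noncomputable def cJGG (a b : Fin 2) : V :=
  -((∑ m, eps m a • vGG b m) + (∑ m, eps m b • vGG a m))
/-- `−ε_{m(a} P_{b)m}`. -/
noncomputable def cJPP (a b : Fin 2) : V :=
  -((∑ m, eps m a • vPP b m) + (∑ m, eps m b • vPP a m))
/-- `−(ε_{am} G_{bm} + ε_{ab} G_{mm})`. -/
noncomputable def cGJJ (a b : Fin 2) : V :=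
  -((∑ m, eps a m • vGG b m) + eps a b • (∑ m, vGG m m))
/-- `−(ε_{am} P_{bm} + ε_{ab} P_{mm})`. -/
noncomputable def cPJJ (a b : Fin 2) : V :=
  -((∑ m, eps a m • vPP b m) + eps a b • (∑ m, vPP m m))
/-- `δ_{a(b} ε_{c)m} G_m`. -/
noncomputable def cJJGG (a b c : Fin 2) : V :=
  ∑ m, (kd a b * eps c m + kd a c * eps b m) • vG m
/-- `δ_{a(b} ε_{c)m} P_m`. -/
noncomputable def cJJPP (a b c : Fin 2) : V :=
  ∑ m, (kd a b * eps c m + kd a c * eps b m) • vP m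
/-- `[G_{ab}, H_c] = −δ_{c(a} ε_{b)m} P_m`. -/
noncomputable def cGGHH (a b c : Fin 2) : V :=
  -(∑ m, (kd c a * eps b m + kd c b * eps a m) • vP m)
/-- `ε_{(a(c} δ_{d)b)}`. -/
def symEG (a b c d : Fin 2) : ℝ :=
  eps a c * kd d b + eps a d * kd c b + eps b c * kd d a + eps b d * kd c a
/-- `ε_{a(b} J*_{c)}`. -/
noncomputable def cPGJs (a b c : Fin 2) : V := eps a b • vJJs c + eps a c • vJJs b
/-- `ε_{a(b} H*_{c)}`. -/
noncomputable def cGGHs (a b c : Fin 2) : V := eps a b • vHHs c + eps a c • vHHs b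
/-- `ε_{am} J*_m`. -/
noncomputable def cJJs (a : Fin 2) : V := ∑ m, eps a m • vJJs m
/-- `ε_{am} H*_m`. -/
noncomputable def cJHs (a : Fin 2) : V := ∑ m, eps a m • vHHs m

/-- Structure constants of `hs₃ebarg1`, exactly the listed brackets (all other
brackets, up to antisymmetry, vanish; in particular `J*`, `H*`, `J*_a`, `H*_a`
commute among themselves). -/
noncomputable def c : Idx → Idx → V
  | .J, .G a => cJG a
  | .G a, .J => -cJG a
  | .J, .P a => cJP a
  | .P a, .J => -cJP a
  | .G a, .H => -cJP a
  | .H, .G a => cJP a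
  | .G a, .G b => eps a b • vHs
  | .P a, .G b => eps a b • vJs
  | .G a, .P b => eps a b • vJs
  | .J, .JJ a => cJJJ a
  | .JJ a, .J => -cJJJ a
  | .J, .GG s => cJGG (fidx s).1 (fidx s).2
  | .GG s, .J => -cJGG (fidx s).1 (fidx s).2
  | .J, .HH a => cJHH a
  | .HH a, .J => -cJHH a
  | .J, .PP s => cJPP (fidx s).1 (fidx s).2
  | .PP s, .J => -cJPP (fidx s).1 (fidx s).2
  | .G a, .JJ b => cGJJ a b
  | .JJ b, .G a => -cGJJ a b
  | .G a, .HH b => cPJJ a b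
  | .HH b, .G a => -cPJJ a b
  | .H, .JJ a => cJHH a
  | .JJ a, .H => -cJHH a
  | .H, .GG s => cJPP (fidx s).1 (fidx s).2
  | .GG s, .H => -cJPP (fidx s).1 (fidx s).2
  | .P a, .JJ b => cPJJ a b
  | .JJ b, .P a => -cPJJ a b
  | .JJ a, .JJ b => eps a b • vJ
  | .JJ a, .GG s => cJJGG a (fidx s).1 (fidx s).2
  | .GG s, .JJ a => -cJJGG a (fidx s).1 (fidx s).2
  | .JJ a, .HH b => eps a b • vH
  | .HH a, .JJ b => eps a b • vH
  | .JJ a, .PP s => cJJPP a (fidx s).1 (fidx s).2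
  | .PP s, .JJ a => -cJJPP a (fidx s).1 (fidx s).2
  | .GG s, .HH d => cGGHH (fidx s).1 (fidx s).2 d
  | .HH d, .GG s => -cGGHH (fidx s).1 (fidx s).2 d
  | .GG s, .GG t => symEG (fidx s).1 (fidx s).2 (fidx t).1 (fidx t).2 • vHs
  | .PP t, .GG s => symEG (fidx t).1 (fidx t).2 (fidx s).1 (fidx s).2 • vJs
  | .GG s, .PP t => -(symEG (fidx t).1 (fidx t).2 (fidx s).1 (fidx s).2) • vJs
  | .P a, .GG s => cPGJs a (fidx s).1 (fidx s).2
  | .GG s, .P a => -cPGJs a (fidx s).1 (fidx s).2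
  | .G a, .GG s => cGGHs a (fidx s).1 (fidx s).2
  | .GG s, .G a => -cGGHs a (fidx s).1 (fidx s).2
  | .G a, .PP s => cPGJs a (fidx s).1 (fidx s).2
  | .PP s, .G a => -cPGJs a (fidx s).1 (fidx s).2
  | .J, .HHs a => cJHs a
  | .HHs a, .J => -cJHs a
  | .J, .JJs a => cJJs a
  | .JJs a, .J => -cJJs a
  | .H, .HHs a => cJJs a
  | .HHs a, .H => -cJJs a
  | .JJ a, .Js => -cJJs a
  | .Js, .JJ a => cJJs a
  | .JJ a, .Hs => -cJHs a
  | .Hs, .JJ a => cJHs a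
  | .JJ a, .JJs b => eps a b • vJs
  | .JJs b, .JJ a => -(eps a b) • vJs
  | .JJ a, .HHs b => eps a b • vHs
  | .HHs b, .JJ a => -(eps a b) • vHs
  | .HH a, .Hs => -cJJs a
  | .Hs, .HH a => cJJs a
  | .HH a, .HHs b => eps a b • vJs
  | .HHs b, .HH a => -(eps a b) • vJs
  | _, _ => 0

/-- The bilinear bracket extending the structure constants. -/
noncomputable def br (x y : V) : V := ∑ i, ∑ j, (x i * y j) • c i j

/-- `⟨P_{ab}, G_{cd}⟩ = δ_{a(c} δ_{d)b} − (2/3) δ_{ab} δ_{cd}`. -/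
noncomputable def mq (s t : Fin 3) : ℝ :=
  kd (fidx s).1 (fidx t).1 * kd (fidx t).2 (fidx s).2
    + kd (fidx s).1 (fidx t).2 * kd (fidx t).1 (fidx s).2
    - (2 / 3) * (kd (fidx s).1 (fidx s).2 * kd (fidx t).1 (fidx t).2)

/-- Matrix of the candidate invariant metric of `hs₃ebarg1`: nonvanishing entries
`⟨P_a,G_b⟩ = δ_{ab}`, `⟨P_{ab},G_{cd}⟩ = δ_{a(c}δ_{d)b} − (2/3)δ_{ab}δ_{cd}`,
`⟨H,H*⟩ = 1`, `⟨J,J*⟩ = 1`, `⟨H_a,H*_b⟩ = δ_{ab}`, `⟨J_a,J*_b⟩ = δ_{ab}`. -/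
noncomputable def M : Idx → Idx → ℝ
  | .P a, .G b => kd a b
  | .G a, .P b => kd a b
  | .PP s, .GG t => mq s t
  | .GG s, .PP t => mq t s
  | .H, .Hs => 1
  | .Hs, .H => 1
  | .J, .Js => 1
  | .Js, .J => 1
  | .HH a, .HHs b => kd a b
  | .HHs a, .HH b => kd a b
  | .JJ a, .JJs b => kd a b
  | .JJs a, .JJ b => kd a b
  | _, _ => 0

/-- The corresponding bilinear form. -/
noncomputable def B (x y : V) : ℝ := ∑ i, ∑ j, x i * y j * M i j

/-! ### Integral model of the structure constants

Integral combinations of basis vectors are represented by lists of coefficient–index pairs, so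
that the identities between structure constants become decidable. -/

/-- A formal integral combination of basis vectors. -/
abbrev IntComb : Type := List (ℤ × Idx)

namespace IntComb

def smul (r : ℤ) (l : IntComb) : IntComb := l.map fun p => (r * p.1, p.2)

/-- The sum of `r m • X m` over `m`. -/
def lin (r : Fin 2 → ℤ) (X : Fin 2 → Idx) : IntComb := [(r 0, X 0), (r 1, X 1)]

/-- The total coefficient of `i` in `l`. -/
def coeff (l : IntComb) (i : Idx) : ℤ := (l.map fun p => if p.2 = i then p.1 else 0).sum

/-- The value on `l` of the linear functional taking integral values `f` on the basis. -/
def pair (l : IntComb) (f : Idx → ℤ) : ℤ := (l.map fun p => p.1 * f p.2).sum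

/-- All coefficients of `l` cancel. -/
def Cancels (l : IntComb) : Prop := ∀ p ∈ l, coeff l p.2 = 0

instance (l : IntComb) : Decidable (Cancels l) :=
  inferInstanceAs (Decidable (∀ p ∈ l, coeff l p.2 = 0))

noncomputable def toV (l : IntComb) : V := (l.map fun p => (p.1 : ℝ) • e p.2).sum

@[simp] theorem toV_nil : toV [] = 0 := rfl

@[simp] theorem toV_cons (p : ℤ × Idx) (l : IntComb) :
    toV (p :: l) = (p.1 : ℝ) • e p.2 + toV l := by
  simp [toV]

@[simp] theorem toV_append (l l' : IntComb) : toV (l ++ l') = toV l + toV l' := by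
  simp [toV]

@[simp] theorem toV_smul (r : ℤ) (l : IntComb) : toV (smul r l) = (r : ℝ) • toV l := by
  induction l with
  | nil => simp [smul]
  | cons p l ih =>
    rw [show smul r (p :: l) = (r * p.1, p.2) :: smul r l from rfl, toV_cons, ih, toV_cons]
    push_cast
    module

@[simp] theorem toV_lin (r : Fin 2 → ℤ) (X : Fin 2 → Idx) :
    toV (lin r X) = ∑ m, (r m : ℝ) • e (X m) := by
  simp [lin, Fin.sum_univ_two]

theorem toV_filter (l : IntComb) : toV (l.filter fun p => p.1 ≠ 0) = toV l := by
  induction l with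
  | nil => rfl
  | cons p l ih =>
    by_cases h : p.1 = 0
    · rw [List.filter_cons_of_neg (by simpa using h), ih, toV_cons, h]
      simp
    · rw [List.filter_cons_of_pos (by simpa using h), toV_cons, toV_cons, ih]

theorem toV_apply (l : IntComb) (i : Idx) : toV l i = coeff l i := by
  induction l with
  | nil => simp [coeff]
  | cons p l ih =>
    rw [toV_cons, Pi.add_apply, ih]
    by_cases h : p.2 = i <;> simp [coeff, e, h, eq_comm]

theorem Cancels.toV_eq_zero {l : IntComb} (h : Cancels l) : toV l = 0 := by
  funext i
  rw [toV_apply]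
  by_cases hi : ∃ p ∈ l, p.2 = i
  · obtain ⟨p, hp, rfl⟩ := hi
    simp [h p hp]
  · push Not at hi
    have : coeff l i = 0 := by
      refine List.sum_eq_zero fun x hx => ?_
      obtain ⟨p, hp, rfl⟩ := List.mem_map.1 hx
      exact if_neg (hi p hp)
    simp [this]

theorem map_toV (f : V →ₗ[ℝ] ℝ) (g : Idx → ℤ) (r : ℝ) (h : ∀ i, r * f (e i) = g i)
    (l : IntComb) : r * f (toV l) = pair l g := by
  induction l with
  | nil => simp [pair]
  | cons p l ih =>
    rw [toV_cons, map_add, map_smul, smul_eq_mul, mul_add, ih, mul_left_comm, h]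
    simp [pair]

end IntComb

open IntComb

def epsInt (a b : Fin 2) : ℤ := if a = b then 0 else if a = 0 then 1 else -1

def kdInt (a b : Fin 2) : ℤ := if a = b then 1 else 0

@[simp] theorem cast_epsInt (a b : Fin 2) : (epsInt a b : ℝ) = eps a b := by
  unfold epsInt eps; split_ifs <;> simp

@[simp] theorem cast_kdInt (a b : Fin 2) : (kdInt a b : ℝ) = kd a b := by
  unfold kdInt kd; split_ifs <;> simp

/-- `ε_{am} X_m`. -/
def rot (X : Fin 2 → Idx) (a : Fin 2) : IntComb := lin (epsInt a) X

/-- `−ε_{m(a} X_{b)m}`. -/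
def rotSym (X : Fin 3 → Idx) (s : Fin 3) : IntComb :=
  smul (-1) (lin (epsInt · (fidx s).1) (fun m => X (sidx (fidx s).2 m)) ++
    lin (epsInt · (fidx s).2) (fun m => X (sidx (fidx s).1 m)))

/-- `−(ε_{am} X_{bm} + ε_{ab} X_{mm})`. -/
def vecVec (X : Fin 3 → Idx) (a b : Fin 2) : IntComb :=
  smul (-1) (lin (epsInt a) (fun m => X (sidx b m)) ++
    smul (epsInt a b) (lin (fun _ => 1) fun m => X (sidx m m)))

/-- `δ_{a(b} ε_{c)m} X_m`. -/
def vecSym (X : Fin 2 → Idx) (a : Fin 2) (s : Fin 3) : IntComb :=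
  lin (fun m => kdInt a (fidx s).1 * epsInt (fidx s).2 m +
    kdInt a (fidx s).2 * epsInt (fidx s).1 m) X

/-- `ε_{a(b} X_{c)}`. -/
def vecSymDual (X : Fin 2 → Idx) (a : Fin 2) (s : Fin 3) : IntComb :=
  [(epsInt a (fidx s).1, X (fidx s).2), (epsInt a (fidx s).2, X (fidx s).1)]

/-- `ε_{(a(c} δ_{d)b)}`. -/
def symEGInt (s t : Fin 3) : ℤ :=
  epsInt (fidx s).1 (fidx t).1 * kdInt (fidx t).2 (fidx s).2 +
    epsInt (fidx s).1 (fidx t).2 * kdInt (fidx t).1 (fidx s).2 +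
    epsInt (fidx s).2 (fidx t).1 * kdInt (fidx t).2 (fidx s).1 +
    epsInt (fidx s).2 (fidx t).2 * kdInt (fidx t).1 (fidx s).1

/-- The structure constants `c` as integral combinations, possibly with zero coefficients. -/
def cIntRaw : Idx → Idx → IntComb
  | .J, .G a => rot .G a
  | .G a, .J => smul (-1) (rot .G a)
  | .J, .P a => rot .P a
  | .P a, .J => smul (-1) (rot .P a)
  | .G a, .H => smul (-1) (rot .P a)
  | .H, .G a => rot .P a
  | .G a, .G b => [(epsInt a b, .Hs)]
  | .P a, .G b => [(epsInt a b, .Js)]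
  | .G a, .P b => [(epsInt a b, .Js)]
  | .J, .JJ a => rot .JJ a
  | .JJ a, .J => smul (-1) (rot .JJ a)
  | .J, .GG s => rotSym .GG s
  | .GG s, .J => smul (-1) (rotSym .GG s)
  | .J, .HH a => rot .HH a
  | .HH a, .J => smul (-1) (rot .HH a)
  | .J, .PP s => rotSym .PP s
  | .PP s, .J => smul (-1) (rotSym .PP s)
  | .G a, .JJ b => vecVec .GG a b
  | .JJ b, .G a => smul (-1) (vecVec .GG a b)
  | .G a, .HH b => vecVec .PP a b
  | .HH b, .G a => smul (-1) (vecVec .PP a b)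
  | .H, .JJ a => rot .HH a
  | .JJ a, .H => smul (-1) (rot .HH a)
  | .H, .GG s => rotSym .PP s
  | .GG s, .H => smul (-1) (rotSym .PP s)
  | .P a, .JJ b => vecVec .PP a b
  | .JJ b, .P a => smul (-1) (vecVec .PP a b)
  | .JJ a, .JJ b => [(epsInt a b, .J)]
  | .JJ a, .GG s => vecSym .G a s
  | .GG s, .JJ a => smul (-1) (vecSym .G a s)
  | .JJ a, .HH b => [(epsInt a b, .H)]
  | .HH a, .JJ b => [(epsInt a b, .H)]
  | .JJ a, .PP s => vecSym .P a s
  | .PP s, .JJ a => smul (-1) (vecSym .P a s)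
  | .GG s, .HH d => smul (-1) (vecSym .P d s)
  | .HH d, .GG s => vecSym .P d s
  | .GG s, .GG t => [(symEGInt s t, .Hs)]
  | .PP t, .GG s => [(symEGInt t s, .Js)]
  | .GG s, .PP t => [(-symEGInt t s, .Js)]
  | .P a, .GG s => vecSymDual .JJs a s
  | .GG s, .P a => smul (-1) (vecSymDual .JJs a s)
  | .G a, .GG s => vecSymDual .HHs a s
  | .GG s, .G a => smul (-1) (vecSymDual .HHs a s)
  | .G a, .PP s => vecSymDual .JJs a s
  | .PP s, .G a => smul (-1) (vecSymDual .JJs a s)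
  | .J, .HHs a => rot .HHs a
  | .HHs a, .J => smul (-1) (rot .HHs a)
  | .J, .JJs a => rot .JJs a
  | .JJs a, .J => smul (-1) (rot .JJs a)
  | .H, .HHs a => rot .JJs a
  | .HHs a, .H => smul (-1) (rot .JJs a)
  | .JJ a, .Js => smul (-1) (rot .JJs a)
  | .Js, .JJ a => rot .JJs a
  | .JJ a, .Hs => smul (-1) (rot .HHs a)
  | .Hs, .JJ a => rot .HHs a
  | .JJ a, .JJs b => [(epsInt a b, .Js)]
  | .JJs b, .JJ a => [(-epsInt a b, .Js)]
  | .JJ a, .HHs b => [(epsInt a b, .Hs)]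
  | .HHs b, .JJ a => [(-epsInt a b, .Hs)]
  | .HH a, .Hs => smul (-1) (rot .JJs a)
  | .Hs, .HH a => rot .JJs a
  | .HH a, .HHs b => [(epsInt a b, .Js)]
  | .HHs b, .HH a => [(-epsInt a b, .Js)]
  | _, _ => []

/-- The structure constants `c` as integral combinations with nonzero coefficients. -/
def cInt (i j : Idx) : IntComb := (cIntRaw i j).filter fun p => p.1 ≠ 0

theorem toV_cInt (i j : Idx) : toV (cInt i j) = c i j := by
  rw [cInt, toV_filter]
  cases i <;> cases j <;>
    simp [-neg_add_rev, neg_add, cIntRaw, c, rot, rotSym, vecVec, vecSym, vecSymDual, symEGInt,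
      symEG, cJG, cJP, cJJJ, cJHH, cJGG, cJPP, cGJJ, cPJJ, cJJGG, cJJPP, cGGHH, cPGJs, cGGHs,
      cJJs, cJHs, vJ, vH, vG, vP, vJJ, vHH, vGG, vPP, vJs, vHs, vJJs, vHHs]

/-- `3 * mq`. -/
def mqInt (s t : Fin 3) : ℤ :=
  3 * (kdInt (fidx s).1 (fidx t).1 * kdInt (fidx t).2 (fidx s).2 +
    kdInt (fidx s).1 (fidx t).2 * kdInt (fidx t).1 (fidx s).2) -
    2 * (kdInt (fidx s).1 (fidx s).2 * kdInt (fidx t).1 (fidx t).2)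

/-- `3 * M`. -/
def MInt : Idx → Idx → ℤ
  | .P a, .G b => 3 * kdInt a b
  | .G a, .P b => 3 * kdInt a b
  | .PP s, .GG t => mqInt s t
  | .GG s, .PP t => mqInt t s
  | .H, .Hs => 3
  | .Hs, .H => 3
  | .J, .Js => 3
  | .Js, .J => 3
  | .HH a, .HHs b => 3 * kdInt a b
  | .HHs a, .HH b => 3 * kdInt a b
  | .JJ a, .JJs b => 3 * kdInt a b
  | .JJs a, .JJ b => 3 * kdInt a b
  | _, _ => 0

theorem cast_MInt (i j : Idx) : (MInt i j : ℝ) = 3 * M i j := by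
  cases i <;> cases j <;> simp [MInt, M, mqInt, mq] <;> ring

/-! ### Reduction to the basis -/

theorem eq_sum_smul_e (x : V) : x = ∑ i, x i • e i := by
  funext j
  simp [e]

theorem basis_induction {p : V → Prop} (basis : ∀ i, p (e i))
    (add : ∀ x y, p x → p y → p (x + y)) (smul : ∀ (r : ℝ) x, p x → p (r • x)) (x : V) :
    p x := by
  rw [eq_sum_smul_e x]
  have zero : p 0 := by simpa using smul 0 _ (basis .J)
  exact Finset.sum_induction _ p add zero fun i _ => smul _ _ (basis i)

/-- The bracket as a bilinear map. -/
noncomputable def brLin : V →ₗ[ℝ] V →ₗ[ℝ] V :=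
  LinearMap.mk₂ ℝ br
    (by intros; simp only [br, Pi.add_apply, add_mul, add_smul, Finset.sum_add_distrib])
    (by intros; simp only [br, Pi.smul_apply, smul_eq_mul, Finset.smul_sum, smul_smul, mul_assoc])
    (by intros; simp only [br, Pi.add_apply, mul_add, add_smul, Finset.sum_add_distrib])
    (by
      intros
      simp only [br, Pi.smul_apply, smul_eq_mul, Finset.smul_sum, smul_smul, mul_left_comm])

theorem br_eq (x y : V) : br x y = brLin x y := rfl

/-- The metric as a bilinear form. -/
noncomputable def BLin : V →ₗ[ℝ] V →ₗ[ℝ] ℝ :=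
  LinearMap.mk₂ ℝ B
    (by intros; simp only [B, Pi.add_apply, add_mul, Finset.sum_add_distrib])
    (by intros; simp only [B, Pi.smul_apply, smul_eq_mul, Finset.mul_sum, mul_assoc])
    (by intros; simp only [B, Pi.add_apply, mul_add, add_mul, Finset.sum_add_distrib])
    (by
      intros
      simp only [B, Pi.smul_apply, smul_eq_mul, Finset.mul_sum, mul_assoc, mul_left_comm])

theorem B_eq (x y : V) : B x y = BLin x y := rfl

theorem brLin_e_e (i j : Idx) : brLin (e i) (e j) = toV (cInt i j) := by
  rw [toV_cInt, ← br_eq]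
  simp [br, e, ite_smul]

theorem BLin_e_e (i j : Idx) : 3 * BLin (e i) (e j) = MInt i j := by
  rw [cast_MInt, ← B_eq]
  simp [B, e]

/-- The bracket of a basis vector with an integral combination. -/
def adInt (i : Idx) (l : IntComb) : IntComb := l.flatMap fun p => smul p.1 (cInt i p.2)

theorem brLin_e_toV (i : Idx) (l : IntComb) : brLin (e i) (toV l) = toV (adInt i l) := by
  induction l with
  | nil => simp [adInt]
  | cons p l ih =>
    rw [show adInt i (p :: l) = smul p.1 (cInt i p.2) ++ adInt i l from rfl, toV_append,
      toV_smul, ← ih, toV_cons, map_add, map_smul, brLin_e_e]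

/-- Twice the dual basis with respect to the metric. -/
def dualInt : Idx → IntComb
  | .J => [(2, .Js)]
  | .H => [(2, .Hs)]
  | .G a => [(2, .P a)]
  | .P a => [(2, .G a)]
  | .JJ a => [(2, .JJs a)]
  | .HH a => [(2, .HHs a)]
  | .GG s => ![[(2, .PP 0), (1, .PP 2)], [(2, .PP 1)], [(1, .PP 0), (2, .PP 2)]] s
  | .PP s => ![[(2, .GG 0), (1, .GG 2)], [(2, .GG 1)], [(1, .GG 0), (2, .GG 2)]] s
  | .Js => [(2, .J)]
  | .Hs => [(2, .H)]
  | .JJs a => [(2, .JJ a)]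
  | .HHs a => [(2, .HH a)]

/-! ### Identities between the structure constants -/

theorem cInt_antisymm : ∀ i j, Cancels (cInt i j ++ cInt j i) := by decide +kernel

theorem cInt_jacobi : ∀ i j k,
    Cancels (adInt i (cInt j k) ++ adInt k (cInt i j) ++ adInt j (cInt k i)) := by
  decide +kernel

theorem MInt_symm : ∀ i j, MInt i j = MInt j i := by decide +kernel

theorem MInt_invariant : ∀ k i j,
    pair (cInt k i) (MInt j) + pair (cInt k j) (MInt i) = 0 := by
  decide +kernel

theorem pair_dualInt : ∀ i j, pair (dualInt i) (MInt j) = if i = j then 6 else 0 := by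
  decide +kernel

/-! ### The Lie algebra and its invariant metric -/

theorem brLin_antisymm (x y : V) : brLin x y + brLin y x = 0 := by
  induction x using basis_induction with
  | add x x' hx hx' =>
    simp only [map_add, LinearMap.add_apply]
    linear_combination hx + hx'
  | smul r x hx =>
    simp only [map_smul, LinearMap.smul_apply, ← smul_add, hx, smul_zero]
  | basis i =>
    induction y using basis_induction with
    | add y y' hy hy' =>
      simp only [map_add, LinearMap.add_apply]
      linear_combination hy + hy'
    | smul r y hy =>
      simp only [map_smul, LinearMap.smul_apply, ← smul_add, hy, smul_zero]
    | basis j => rw [brLin_e_e, brLin_e_e, ← toV_append, (cInt_antisymm i j).toV_eq_zero]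

theorem brLin_jacobi (x y z : V) :
    brLin x (brLin y z) + brLin z (brLin x y) + brLin y (brLin z x) = 0 := by
  induction x using basis_induction with
  | add x x' hx hx' =>
    simp only [map_add, LinearMap.add_apply]
    linear_combination hx + hx'
  | smul r x hx =>
    simp only [map_smul, LinearMap.smul_apply, ← smul_add, hx, smul_zero]
  | basis i =>
    induction y using basis_induction with
    | add y y' hy hy' =>
      simp only [map_add, LinearMap.add_apply]
      linear_combination hy + hy'
    | smul r y hy =>
      simp only [map_smul, LinearMap.smul_apply, ← smul_add, hy, smul_zero]
    | basis j =>
      induction z using basis_induction with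
      | add z z' hz hz' =>
        simp only [map_add, LinearMap.add_apply]
        linear_combination hz + hz'
      | smul r z hz =>
        simp only [map_smul, LinearMap.smul_apply, ← smul_add, hz, smul_zero]
      | basis k =>
        simp only [brLin_e_e, brLin_e_toV, ← toV_append, (cInt_jacobi i j k).toV_eq_zero]

theorem BLin_symm (x y : V) : BLin x y = BLin y x := by
  induction x using basis_induction with
  | add x x' hx hx' => simp only [map_add, LinearMap.add_apply, hx, hx']
  | smul r x hx => simp only [map_smul, LinearMap.smul_apply, hx]
  | basis i =>
    induction y using basis_induction with
    | add y y' hy hy' => simp only [map_add, LinearMap.add_apply, hy, hy']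
    | smul r y hy => simp only [map_smul, LinearMap.smul_apply, hy]
    | basis j =>
      have h : (MInt i j : ℝ) = MInt j i := by rw [MInt_symm]
      linarith [BLin_e_e i j, BLin_e_e j i]

theorem BLin_invariant (z x y : V) : BLin y (brLin z x) + BLin x (brLin z y) = 0 := by
  induction z using basis_induction with
  | add z z' hz hz' =>
    simp only [map_add, LinearMap.add_apply]
    linear_combination hz + hz'
  | smul r z hz =>
    simp only [map_smul, LinearMap.smul_apply, smul_eq_mul]
    linear_combination r * hz
  | basis k =>
    induction x using basis_induction with
    | add x x' hx hx' =>
      simp only [map_add, LinearMap.add_apply]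
      linear_combination hx + hx'
    | smul r x hx =>
      simp only [map_smul, LinearMap.smul_apply, smul_eq_mul]
      linear_combination r * hx
    | basis i =>
      induction y using basis_induction with
      | add y y' hy hy' =>
        simp only [map_add, LinearMap.add_apply]
        linear_combination hy + hy'
      | smul r y hy =>
        simp only [map_smul, LinearMap.smul_apply, smul_eq_mul]
        linear_combination r * hy
      | basis j =>
        have h : ((pair (cInt k i) (MInt j) + pair (cInt k j) (MInt i) : ℤ) : ℝ) = 0 := by
          rw [MInt_invariant, Int.cast_zero]
        rw [Int.cast_add, ← map_toV (BLin (e j)) (MInt j) 3 (BLin_e_e j),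
          ← map_toV (BLin (e i)) (MInt i) 3 (BLin_e_e i), ← brLin_e_e, ← brLin_e_e] at h
        linarith

theorem BLin_dualInt (x : V) (i : Idx) : BLin x (toV (dualInt i)) = 2 * x i := by
  induction x using basis_induction with
  | add x x' hx hx' =>
    simp only [map_add, LinearMap.add_apply, Pi.add_apply, hx, hx']
    ring
  | smul r x hx =>
    simp only [map_smul, LinearMap.smul_apply, Pi.smul_apply, smul_eq_mul, hx]
    ring
  | basis j =>
    have h := map_toV (BLin (e j)) (MInt j) 3 (BLin_e_e j) (dualInt i)
    rw [pair_dualInt] at h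
    by_cases hij : i = j <;> simp only [e, hij, if_true, if_false] at h ⊢ <;> push_cast at h <;>
      linarith

/-- `hs₃ebarg1` is a Lie algebra (the listed brackets are
skew-symmetric and satisfy the Jacobi identity), and the stated bilinear form is
an invariant metric on it (symmetric, invariant, nondegenerate). -/
theorem hs3ebarg1_lie_algebra_and_invariant_metric :
    (∀ x y : V, br x y = -br y x) ∧
    (∀ x y z : V, br x (br y z) + br z (br x y) + br y (br z x) = 0) ∧
    (∀ x y : V, B x y = B y x) ∧
    (∀ z x y : V, B (br z x) y + B x (br z y) = 0) ∧
    (∀ x : V, (∀ y : V, B x y = 0) → x = 0) := by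
  refine ⟨fun x y => eq_neg_of_add_eq_zero_left (brLin_antisymm x y), brLin_jacobi, BLin_symm,
    fun z x y => ?_, fun x h => funext fun i => ?_⟩
  · simpa only [B_eq, br_eq, BLin_symm (brLin z x) y] using BLin_invariant z x y
  · have := BLin_dualInt x i
    rw [← B_eq, h] at this
    simpa using this.symm

end HS3EBarg1
end

section
/- The asymptotic symmetry algebra of Carroll gravity is a Lie algebra: on the complex vector space with basis {J, H} ∪ {P^a_n, G^a_n : a ∈ {1,2}, n ∈ ℤ}, the bracket defined by [J, P^a_n] = ε_{ab} P^b_n, [J, G^a_n] = ε_{ab} G^b_n, [P^a_n, G^b_m] = −(ε_{ab} + i·n·δ_{ab}) H δ_{n+m,0}, with H central and all other brackets among basis elements zero (extended bilinearly, with [X,Y] = −[Y,X]), satisfies the Jacobi identity and hence defines an infinite-dimensional complex Lie algebra. Moreover, the span of {J, H, P^1_0, P^2_0, G^1_0, G^2_0} is a Lie subalgebra isomorphic to the (complexified) Carroll algebra, i.e., it satisfies [J, P^a_0] = ε_{ab} P^b_0, [J, G^a_0] = ε_{ab} G^b_0, [P^a_0, G^b_0] = −ε_{ab} H with H central. -/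
namespace CarrollASA

/-- Basis of the asymptotic symmetry algebra of Carroll gravity:
`J`, `H`, and `P^a_n`, `G^a_n` for `a ∈ {1,2}`, `n ∈ ℤ`. -/
inductive Idx : Type
  | J : Idx
  | H : Idx
  | P : Fin 2 → ℤ → Idx
  | G : Fin 2 → ℤ → Idx

/-- The free complex vector space on the basis `Idx`. -/
abbrev V : Type := Idx →₀ ℂ

/-- Basis vectors. -/
noncomputable def e (i : Idx) : V := Finsupp.single i 1

/-- The antisymmetric ε-symbol, `ε₁₂ = 1`. -/
def eps (a b : Fin 2) : ℂ := if a = b then 0 else if a = 0 then 1 else -1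

/-- Kronecker delta. -/
def kd (a b : Fin 2) : ℂ := if a = b then 1 else 0

/-- Structure constants: `[J, P^a_n] = ε_{ab} P^b_n`, `[J, G^a_n] = ε_{ab} G^b_n`,
`[P^a_n, G^b_m] = −(ε_{ab} + i·n·δ_{ab}) H δ_{n+m,0}`, `H` central, and all other
brackets among basis elements zero. -/
noncomputable def c : Idx → Idx → V
  | .J, .P a n => ∑ b, eps a b • e (.P b n)
  | .P a n, .J => -(∑ b, eps a b • e (.P b n))
  | .J, .G a n => ∑ b, eps a b • e (.G b n)
  | .G a n, .J => -(∑ b, eps a b • e (.G b n))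
  | .P a n, .G b m =>
      if n + m = 0 then (-(eps a b + Complex.I * (n : ℂ) * kd a b)) • e .H else 0
  | .G a n, .P b m =>
      if n + m = 0 then (eps b a + Complex.I * (m : ℂ) * kd b a) • e .H else 0
  | _, _ => 0

/-- The bilinear extension of the structure constants. -/
noncomputable def br (x y : V) : V :=
  x.sum fun i xi => y.sum fun j yj => (xi * yj) • c i j

/-- The spin-2 (zero-mode) generators `J, H, P^a_0, G^a_0`. -/
noncomputable def carrollGens : Set V :=
  {e .J, e .H, e (.P 0 0), e (.P 1 0), e (.G 0 0), e (.G 1 0)}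

/-- The bracket as a bilinear map. -/
noncomputable def brHom : V →ₗ[ℂ] V →ₗ[ℂ] V :=
  Finsupp.linearCombination ℂ fun i => Finsupp.linearCombination ℂ (c i)

theorem br_eq_brHom (x y : V) : br x y = brHom x y := by
  simp [br, brHom, Finsupp.linearCombination_apply, Finsupp.sum, LinearMap.sum_apply,
    Finset.smul_sum, mul_smul]

theorem brHom_e (i j : Idx) : brHom (e i) (e j) = c i j := by
  simp [brHom, e]

theorem single_eq_smul_e (i : Idx) (r : ℂ) : Finsupp.single i r = r • e i := by
  simp [e]

theorem span_e : Submodule.span ℂ (Set.range e) = ⊤ := by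
  refine Submodule.eq_top_iff'.2 fun x => ?_
  induction x using Finsupp.induction_linear with
  | zero => exact zero_mem _
  | add x y hx hy => exact add_mem hx hy
  | single i r =>
    rw [single_eq_smul_e]
    exact Submodule.smul_mem _ _ (Submodule.subset_span ⟨i, rfl⟩)

theorem linearMap_ext {M : Type*} [AddCommMonoid M] [Module ℂ M] {f g : V →ₗ[ℂ] M}
    (h : ∀ i, f (e i) = g (e i)) : f = g :=
  LinearMap.ext_on_range span_e h

theorem c_skew (i j : Idx) : c i j = -c j i := by
  cases i <;> cases j <;> simp only [c, neg_neg, neg_zero]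
  all_goals simp only [add_comm (_ : ℤ)]
  all_goals split_ifs <;> simp only [neg_smul, neg_neg, neg_zero]

theorem brHom_skew (x y : V) : brHom x y = -brHom y x := by
  have h : brHom + brHom.flip = 0 := linearMap_ext fun i => linearMap_ext fun j => by
    simpa [brHom_e] using eq_neg_iff_add_eq_zero.1 (c_skew i j)
  exact eq_neg_of_add_eq_zero_left (LinearMap.congr_fun₂ h x y)

theorem c_H_left (i : Idx) : c .H i = 0 := by
  cases i <;> rfl

theorem brHom_H_left (x : V) : brHom (e .H) x = 0 := by
  have h : brHom (e .H) = 0 := linearMap_ext fun i => by simp [brHom_e, c_H_left]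
  rw [h, LinearMap.zero_apply]

theorem brHom_H_right (x : V) : brHom x (e .H) = 0 := by
  rw [brHom_skew, brHom_H_left, neg_zero]

theorem jacobi_e (i j k : Idx) :
    brHom (e i) (c j k) + brHom (e k) (c i j) + brHom (e j) (c k i) = 0 := by
  cases i <;> cases j <;> cases k <;>
    simp only [c, apply_ite (brHom _), map_neg, map_smul, map_zero, map_sum,
      brHom_e, brHom_H_right, smul_zero, neg_zero, add_zero, zero_add, ite_self,
      Finset.sum_const_zero, neg_add_cancel, add_neg_cancel]
  all_goals
    rename_i a n b m
    rw [add_comm m n]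
    split_ifs
    · fin_cases a <;> fin_cases b <;> simp [eps, kd]
    · simp

theorem brHom_jacobi (x y z : V) :
    brHom x (brHom y z) + brHom z (brHom x y) + brHom y (brHom z x) = 0 := by
  induction x using Finsupp.induction_linear with
  | zero => simp
  | add x x' hx hx' =>
    simp only [map_add, LinearMap.add_apply]
    linear_combination (norm := module) hx + hx'
  | single i r =>
  induction y using Finsupp.induction_linear with
  | zero => simp
  | add y y' hy hy' =>
    simp only [map_add, LinearMap.add_apply]
    linear_combination (norm := module) hy + hy'
  | single j s =>
  induction z using Finsupp.induction_linear with
  | zero => simp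
  | add z z' hz hz' =>
    simp only [map_add, LinearMap.add_apply]
    linear_combination (norm := module) hz + hz'
  | single k t =>
  simp only [single_eq_smul_e, map_smul, LinearMap.smul_apply, brHom_e]
  linear_combination (norm := module) (r * s * t) • jacobi_e i j k

theorem infinite_idx : Infinite Idx :=
  Infinite.of_injective (Idx.P 0) fun _ _ h => by injection h

theorem not_finiteDimensional : ¬ FiniteDimensional ℂ V := by
  have := infinite_idx
  intro h
  exact not_finite_iff_infinite.2 this
    ((Finsupp.basisSingleOne (R := ℂ) (ι := Idx)).linearIndependent.finite)

theorem e_P_zero_mem (a : Fin 2) : e (.P a 0) ∈ Submodule.span ℂ carrollGens := by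
  apply Submodule.subset_span
  fin_cases a <;> simp [carrollGens]

theorem e_G_zero_mem (a : Fin 2) : e (.G a 0) ∈ Submodule.span ℂ carrollGens := by
  apply Submodule.subset_span
  fin_cases a <;> simp [carrollGens]

theorem e_H_mem : e .H ∈ Submodule.span ℂ carrollGens :=
  Submodule.subset_span (by simp [carrollGens])

theorem brHom_mem_of_mem_carrollGens {x y : V} (hx : x ∈ carrollGens) (hy : y ∈ carrollGens) :
    brHom x y ∈ Submodule.span ℂ carrollGens := by
  simp only [carrollGens, Set.mem_insert_iff, Set.mem_singleton_iff] at hx hy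
  have sum_P (a : Fin 2) := Submodule.sum_mem (t := Finset.univ) (Submodule.span ℂ carrollGens)
    fun b _ => Submodule.smul_mem _ (eps a b) (e_P_zero_mem b)
  have sum_G (a : Fin 2) := Submodule.sum_mem (t := Finset.univ) (Submodule.span ℂ carrollGens)
    fun b _ => Submodule.smul_mem _ (eps a b) (e_G_zero_mem b)
  rcases hx with rfl | rfl | rfl | rfl | rfl | rfl <;>
    rcases hy with rfl | rfl | rfl | rfl | rfl | rfl <;>
    simp only [brHom_e, c, add_zero, if_true, neg_mem_iff, zero_mem, sum_P, sum_G,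
      Submodule.smul_mem _ _ e_H_mem]

theorem brHom_mem_span {x y : V} (hx : x ∈ Submodule.span ℂ carrollGens)
    (hy : y ∈ Submodule.span ℂ carrollGens) : brHom x y ∈ Submodule.span ℂ carrollGens := by
  have h := Submodule.apply_mem_map₂ brHom hx hy
  rw [Submodule.map₂_span_span] at h
  refine Submodule.span_le.2 ?_ h
  rintro _ ⟨x, hx, y, hy, rfl⟩
  exact brHom_mem_of_mem_carrollGens hx hy

/-- the bracket of the asymptotic symmetry algebra of Carroll
gravity is bilinear, skew-symmetric, satisfies the Jacobi identity (hence defines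
an infinite-dimensional complex Lie algebra), takes the stated values on basis
elements with `H` central, and the span of `{J, H, P^a_0, G^a_0}` is a Lie
subalgebra isomorphic to the complexified Carroll algebra, i.e. it satisfies
`[J,P^a_0] = ε_{ab} P^b_0`, `[J,G^a_0] = ε_{ab} G^b_0`,
`[P^a_0,G^b_0] = −ε_{ab} H` with `H` central. -/
theorem carroll_asymptotic_symmetry_algebra :
    -- bilinearity
    (∀ x x' y : V, br (x + x') y = br x y + br x' y) ∧
    (∀ (s : ℂ) (x y : V), br (s • x) y = s • br x y) ∧
    (∀ x y y' : V, br x (y + y') = br x y + br x y') ∧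
    (∀ (s : ℂ) (x y : V), br x (s • y) = s • br x y) ∧
    -- skew-symmetry
    (∀ x y : V, br x y = -br y x) ∧
    -- Jacobi identity
    (∀ x y z : V, br x (br y z) + br z (br x y) + br y (br z x) = 0) ∧
    -- values on basis elements
    (∀ (a : Fin 2) (n : ℤ), br (e .J) (e (.P a n)) = ∑ b, eps a b • e (.P b n)) ∧
    (∀ (a : Fin 2) (n : ℤ), br (e .J) (e (.G a n)) = ∑ b, eps a b • e (.G b n)) ∧
    (∀ (a b : Fin 2) (n m : ℤ), br (e (.P a n)) (e (.G b m)) =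
      if n + m = 0 then (-(eps a b + Complex.I * (n : ℂ) * kd a b)) • e .H else 0) ∧
    -- `H` is central
    (∀ x : V, br (e .H) x = 0) ∧ (∀ x : V, br x (e .H) = 0) ∧
    -- the algebra is infinite dimensional
    (¬ FiniteDimensional ℂ V) ∧
    -- the zero modes span a subalgebra satisfying the Carroll relations
    (∀ x ∈ Submodule.span ℂ carrollGens, ∀ y ∈ Submodule.span ℂ carrollGens,
      br x y ∈ Submodule.span ℂ carrollGens) ∧
    (∀ a : Fin 2, br (e .J) (e (.P a 0)) = ∑ b, eps a b • e (.P b 0)) ∧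
    (∀ a : Fin 2, br (e .J) (e (.G a 0)) = ∑ b, eps a b • e (.G b 0)) ∧
    (∀ a b : Fin 2, br (e (.P a 0)) (e (.G b 0)) = -(eps a b) • e .H) := by
  simp only [br_eq_brHom, brHom_e]
  refine ⟨by simp, by simp, by simp, by simp, brHom_skew, brHom_jacobi, fun _ _ => rfl,
    fun _ _ => rfl, fun _ _ _ _ => rfl, brHom_H_left, brHom_H_right, not_finiteDimensional,
    fun _ hx _ hy => brHom_mem_span hx hy, fun _ => rfl, fun _ => rfl, fun a b => ?_⟩
  simp [c]

end CarrollASA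
end
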